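/- Symmetry of the specialized coefficients under conjugation: Let n ≥ 1 and let λ, μ, ν be partitions such that λ, μ, ν and their conjugates λ^t, μ^t, ν^t all have at most n parts. Then f^{ν^t}_{λ^t μ^t} = f^ν_{λμ}. -/

import Mathlib

open scoped BigOperators

namespace FactorialLR

/-- Column order on cells: right-most column first, top to bottom within a column. -/
def ColLT (a b : ℕ × ℕ) : Prop :=
  b.2 < a.2 ∨ (a.2 = b.2 ∧ a.1 < b.1)

instance (a b : ℕ × ℕ) : Decidable (ColLT a b) := by
  unfold ColLT; infer_instance

/-- A filling of the cell set `s` with entries in `Fin n` (`0`-based, representing the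
`1`-based entries `{1,…,n}`) is semistandard if it weakly increases along rows and strictly
increases down columns. -/
def IsSsyt {n : ℕ} (s : Finset (ℕ × ℕ)) (T : s → Fin n) : Prop :=
  (∀ c c' : s, (c : ℕ × ℕ).1 = (c' : ℕ × ℕ).1 → (c : ℕ × ℕ).2 ≤ (c' : ℕ × ℕ).2 → T c ≤ T c') ∧
  (∀ c c' : s, (c : ℕ × ℕ).1 < (c' : ℕ × ℕ).1 → (c : ℕ × ℕ).2 = (c' : ℕ × ℕ).2 → T c < T c')

/-- `μ → ν` : `ν` is obtained from `μ` by adding a single cell. -/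
def Covers (μ ν : YoungDiagram) : Prop :=
  μ ≤ ν ∧ ν.card = μ.card + 1

/-- Chains `μ = ρ⁽⁰⁾ → ρ⁽¹⁾ → ⋯ → ρ⁽ˡ⁾ = ν` of Young diagrams, encoded as lists. -/
def chainSet (μ ν : YoungDiagram) : Set (List YoungDiagram) :=
  {L | L.Chain' Covers ∧ L.head? = some μ ∧ L.getLast? = some ν}

/-- The row (`0`-based) of the unique cell of `τ / σ`, when `σ → τ`. -/
def stepRow (σ τ : YoungDiagram) : ℕ :=
  (τ.cells \ σ.cells).sup Prod.fst

/-- The set `𝒯(θ,R)` for a sequence `R` (encoded as the list `L`): pairs `(T,β)` where `T`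
is a semistandard filling of `s` and `β` lists the barred cells `α_1 < ⋯ < α_l` in column
order, with `T(α_i) = r_i` (the row of `ρ⁽ⁱ⁾/ρ⁽ⁱ⁻¹⁾`). -/
def TSet {n : ℕ} (s : Finset (ℕ × ℕ)) (L : List YoungDiagram) :
    Set ((s → Fin n) × (Fin (L.length - 1) → s)) :=
  {p | IsSsyt s p.1 ∧
    (∀ i j : Fin (L.length - 1), i < j → ColLT (p.2 i : ℕ × ℕ) (p.2 j : ℕ × ℕ)) ∧
    (∀ i : Fin (L.length - 1),
      (p.1 (p.2 i) : ℕ) = stepRow (L.getD (i : ℕ) ⊥) (L.getD ((i : ℕ) + 1) ⊥))}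

/-- For an unbarred cell `c`, `ρ(c) = ρ⁽ⁱ⁾` where `i` is maximal with `α_i < c` in
column order, i.e. `i` is the number of barred cells preceding `c`. -/
def rhoOf {s : Finset (ℕ × ℕ)} (L : List YoungDiagram)
    (β : Fin (L.length - 1) → s) (c : s) : YoungDiagram :=
  L.getD ((Finset.univ.filter
    (fun i : Fin (L.length - 1) => ColLT (β i : ℕ × ℕ) (c : ℕ × ℕ))).card) ⊥

/-- The specialized factorial Littlewood–Richardson coefficient
`f^ν_{λμ} = Σ_{T ∈ 𝒯(λ,ν/μ)} ∏_{α unbarred} (ρ(α)_{T(α)} + n − 2 T(α) − c(α) + 1)`,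
where `T(α)` is the `1`-based entry and `ρ(α)_{T(α)}` the `T(α)`-th part of `ρ(α)`. -/
noncomputable def fcoef (n : ℕ) (lam μ ν : YoungDiagram) : ℤ :=
  ∑ᶠ L ∈ chainSet μ ν,
    ∑ᶠ p ∈ TSet (n := n) lam.cells L,
      ∏ c : lam.cells,
        if ∃ i, p.2 i = c then 1
        else ((rhoOf L p.2 c).rowLen (p.1 c) : ℤ) + (n : ℤ) - 2 * ((p.1 c : ℤ) + 1)
              - (((c : ℕ × ℕ).2 : ℤ) - ((c : ℕ × ℕ).1 : ℤ)) + 1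

end FactorialLR
namespace FactorialLR

/-- The subring of functions symmetric in two coordinates. -/
def symS {n : ℕ} (i i' : Fin n) : Subring ((Fin n → ℤ) → ℤ) where
  carrier := {p | ∀ x, p (x ∘ Equiv.swap i i') = p x}
  mul_mem' := by intro a b ha hb x; simp [ha x, hb x]
  one_mem' := by intro x; rfl
  add_mem' := by intro a b ha hb x; simp [ha x, hb x]
  zero_mem' := by intro x; rfl
  neg_mem' := by intro a ha x; simp [ha x]

theorem mem_symS {n : ℕ} {i i' : Fin n} {p : (Fin n → ℤ) → ℤ} :
    p ∈ symS i i' ↔ ∀ x, p (x ∘ Equiv.swap i i') = p x := Iff.rfl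

def Compat {n m m' : ℕ} (v : Fin m' → Fin n) (u : Fin m → Fin n) : Prop :=
  ∀ (r : ℕ) (h : r < m) (h' : r < m'), v ⟨r, h'⟩ ≤ u ⟨r, h⟩

noncomputable instance {n m m' : ℕ} (v : Fin m' → Fin n) (u : Fin m → Fin n) : Decidable (Compat v u) :=
  Classical.propDecidable _

noncomputable instance {n m : ℕ} (v : Fin m → Fin n) : Decidable (StrictMono v) :=
  Classical.propDecidable _

/-- admissible columns to the left of `u` -/
noncomputable def colSet {n m : ℕ} (m' : ℕ) (u : Fin m → Fin n) : Finset (Fin m' → Fin n) :=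
  Finset.univ.filter fun v => StrictMono v ∧ Compat v u

theorem mem_colSet {n m m' : ℕ} {u : Fin m → Fin n} {v : Fin m' → Fin n} :
    v ∈ colSet m' u ↔ StrictMono v ∧ Compat v u := by simp [colSet]

/-- shift of a cell -/
def bsh {n m : ℕ} (j : ℕ) (v : Fin m → Fin n) (r : Fin m) : ℤ := (v r : ℤ) + j - (r : ℤ)

/-- column weight -/
def wcol {n m : ℕ} (j : ℕ) (v : Fin m → Fin n) : (Fin n → ℤ) → ℤ :=
  fun x => ∏ r, (x (v r) - bsh j v r)

noncomputable def Gf {n : ℕ} (ℓ : ℕ → ℕ) : (j : ℕ) → {m : ℕ} → (Fin m → Fin n) → ((Fin n → ℤ) → ℤ)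
  | 0, _, _ => 1
  | j + 1, _, u => ∑ v ∈ colSet (ℓ j) u, wcol j v * Gf ℓ j v

open Classical in
noncomputable def star {n m : ℕ} (i i' : Fin n) (v : Fin m → Fin n) : Fin m → Fin n :=
  if (∃ r, v r = i) ∧ (∃ r, v r = i') then v else Equiv.swap i i' ∘ v

theorem star_star {n m : ℕ} (i i' : Fin n) (v : Fin m → Fin n) : star i i' (star i i' v) = v := by
  unfold star
  by_cases h : (∃ r, v r = i) ∧ (∃ r, v r = i')
  · simp [h]
  · have h2 : ¬ ((∃ r, (Equiv.swap i i' ∘ v) r = i) ∧ (∃ r, (Equiv.swap i i' ∘ v) r = i')) := by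
      rintro ⟨⟨r, hr⟩, ⟨s, hs⟩⟩
      apply h
      refine ⟨⟨s, ?_⟩, ⟨r, ?_⟩⟩
      · have := congrArg (Equiv.swap i i') hs
        simpa using this
      · have := congrArg (Equiv.swap i i') hr
        simpa using this
    rw [if_neg h, if_neg h2]
    funext r; simp

theorem swap_strictMono {n m : ℕ} {i i' : Fin n} (hii : (i' : ℕ) = i + 1) {v : Fin m → Fin n}
    (hv : StrictMono v) (h : ¬ ((∃ r, v r = i) ∧ (∃ r, v r = i'))) :
    StrictMono (Equiv.swap i i' ∘ v) := by
  intro a b hab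
  have h1 := hv hab
  have h2 : ¬ (v a = i ∧ v b = i') := fun hh => h ⟨⟨a, hh.1⟩, ⟨b, hh.2⟩⟩
  simp only [Function.comp, Equiv.swap_apply_def]
  split_ifs <;> simp only [Fin.lt_def, Fin.ext_iff] at * <;> omega

theorem star_strictMono {n m : ℕ} {i i' : Fin n} (hii : (i' : ℕ) = i + 1) {v : Fin m → Fin n}
    (hv : StrictMono v) : StrictMono (star i i' v) := by
  unfold star
  split_ifs with h
  · exact hv
  · exact swap_strictMono hii hv h

theorem mul_pair_mem {n : ℕ} {i i' : Fin n} (a : ℤ) :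
    (fun x : Fin n → ℤ => (x i - a) * (x i' - a)) ∈ symS i i' := by
  intro x; simp; ring

theorem add_pair_mem {n : ℕ} {i i' : Fin n} (a : ℤ) :
    (fun x : Fin n → ℤ => x i + x i' - a) ∈ symS i i' := by
  intro x; simp; ring

theorem single_mem {n : ℕ} {i i' t : Fin n} (h : t ≠ i) (h' : t ≠ i') (a : ℤ) :
    (fun x : Fin n → ℤ => x t - a) ∈ symS i i' := by
  intro x; simp [Equiv.swap_apply_of_ne_of_ne h h']

theorem wcol_eq {n m : ℕ} (j : ℕ) (v : Fin m → Fin n) :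
    wcol j v = ∏ r, (fun x : Fin n → ℤ => x (v r) - bsh j v r) := by
  funext x; simp [wcol, Finset.prod_apply]

/-- column containing both or neither -/
theorem wcol_mem {n m : ℕ} {i i' : Fin n} (hii : (i' : ℕ) = i + 1) (j : ℕ) {v : Fin m → Fin n}
    (hv : StrictMono v) (h : (∃ r, v r = i) ↔ (∃ r, v r = i')) : wcol j v ∈ symS i i' := by
  rw [wcol_eq]
  by_cases hi : ∃ r, v r = i
  · obtain ⟨s, hs⟩ := h.1 hi
    obtain ⟨r, hr⟩ := hi
    have hrs : r < s := hv.lt_iff_lt.1 (by rw [hr, hs, Fin.lt_def]; omega)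
    have hs1 : (s : ℕ) = r + 1 := by
      by_contra hne
      have hlt : (r : ℕ) + 1 < s := by rw [Fin.lt_def] at hrs; omega
      have h1 : r < (⟨r + 1, by omega⟩ : Fin m) := by rw [Fin.lt_def]; simp
      have h2 : (⟨r + 1, by omega⟩ : Fin m) < s := by rw [Fin.lt_def]; simpa using hlt
      have h3 := hv h1
      have h4 := hv h2
      rw [hr] at h3; rw [hs] at h4
      rw [Fin.lt_def] at h3 h4; omega
    rw [← Finset.mul_prod_erase _ _ (Finset.mem_univ r),
      ← Finset.mul_prod_erase _ _ (Finset.mem_erase.2 ⟨hrs.ne', Finset.mem_univ s⟩), ← mul_assoc]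
    apply Subring.mul_mem
    · have : (fun x : Fin n → ℤ => x (v r) - bsh j v r) * (fun x => x (v s) - bsh j v s)
          = fun x => (x i - bsh j v r) * (x i' - bsh j v r) := by
        funext x
        have : bsh j v s = bsh j v r := by
          unfold bsh; rw [hr, hs, hii, hs1]; push_cast; ring
        simp [hr, hs, this]
      rw [this]; exact mul_pair_mem _
    · apply Subring.prod_mem
      intro t ht
      simp only [Finset.mem_erase] at ht
      apply single_mem
      · rw [← hr]; exact fun e => ht.2.1 (hv.injective e)
      · rw [← hs]; exact fun e => ht.1 (hv.injective e)
  · have hi' : ¬ ∃ r, v r = i' := fun e => hi (h.2 e)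
    apply Subring.prod_mem
    intro t _
    exact single_mem (fun e => hi ⟨t, e⟩) (fun e => hi' ⟨t, e⟩) _

/-- factorisation of a column containing `i` but not `i'`. -/
theorem wcol_fact {n m : ℕ} {i i' : Fin n} (hii : (i' : ℕ) = i + 1) (j : ℕ) {v : Fin m → Fin n}
    (hv : StrictMono v) {r : Fin m} (hr : v r = i) (hi' : ¬ ∃ r, v r = i') :
    ∃ c ∈ symS i i', wcol j v = c * (fun x => x i - ((i : ℤ) + j - r)) ∧
      wcol j (Equiv.swap i i' ∘ v) = c * (fun x => x i' - ((i : ℤ) + j - r + 1)) := by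
  refine ⟨∏ s ∈ Finset.univ.erase r, (fun x : Fin n → ℤ => x (v s) - bsh j v s), ?_, ?_, ?_⟩
  · apply Subring.prod_mem
    intro t ht
    apply single_mem
    · rw [← hr]; exact fun e => (Finset.mem_erase.1 ht).1 (hv.injective e)
    · exact fun e => hi' ⟨t, e⟩
  · rw [wcol_eq, ← Finset.prod_erase_mul _ _ (Finset.mem_univ r)]
    congr 1; funext x; simp [bsh, hr]
  · rw [wcol_eq, ← Finset.prod_erase_mul _ _ (Finset.mem_univ r)]
    congr 1
    · apply Finset.prod_congr rfl
      intro t ht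
      have h1 : v t ≠ i := by
        rw [← hr]; exact fun e => (Finset.mem_erase.1 ht).1 (hv.injective e)
      have h2 : v t ≠ i' := fun e => hi' ⟨t, e⟩
      funext x; simp [bsh, Equiv.swap_apply_of_ne_of_ne h1 h2]
    · funext x; simp [bsh, hr, hii]; ring

def SProp {n : ℕ} (ℓ : ℕ → ℕ) (i i' : Fin n) (j : ℕ) : Prop :=
  ∀ {m : ℕ} (u : Fin m → Fin n), (∀ c < j, m ≤ ℓ c) → StrictMono u →
    ((∃ r, u r = i) → (∃ r, u r = i')) → Gf ℓ j u ∈ symS i i'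

def PProp {n : ℕ} (ℓ : ℕ → ℕ) (i i' : Fin n) (j : ℕ) : Prop :=
  ∀ {m : ℕ} (u : Fin m → Fin n), (∀ c < j, m ≤ ℓ c) → StrictMono u →
    ∀ r, u r = i → (¬ ∃ r, u r = i') →
    (fun x : Fin n → ℤ => x i - ((i : ℤ) + j - r)) * Gf ℓ j u +
      (fun x : Fin n → ℤ => x i' - ((i : ℤ) + j - r + 1)) * Gf ℓ j (Equiv.swap i i' ∘ u)
      ∈ symS i i'

theorem swap_no {n m : ℕ} {i i' : Fin n} {v : Fin m → Fin n} (h : ¬ ∃ r, v r = i) :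
    ¬ ∃ r, (Equiv.swap i i' ∘ v) r = i' := by
  rintro ⟨r, hr⟩
  apply h
  refine ⟨r, ?_⟩
  have := congrArg (Equiv.swap i i') hr
  simpa using this

theorem swap_yes {n m : ℕ} {i i' : Fin n} {v : Fin m → Fin n} {r} (h : v r = i') :
    (Equiv.swap i i' ∘ v) r = i := by simp [h]

theorem pair_mem {n : ℕ} {ℓ : ℕ → ℕ} {i i' : Fin n} (hii : (i' : ℕ) = i + 1) {j : ℕ}
    (hP : PProp ℓ i i' j) {m : ℕ} {v : Fin m → Fin n} (hm : ∀ c < j, m ≤ ℓ c)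
    (hv : StrictMono v) {r} (hr : v r = i) (hi' : ¬ ∃ r, v r = i') :
    wcol j v * Gf ℓ j v + wcol j (Equiv.swap i i' ∘ v) * Gf ℓ j (Equiv.swap i i' ∘ v)
      ∈ symS i i' := by
  obtain ⟨c, hc, h1, h2⟩ := wcol_fact hii j hv hr hi'
  rw [h1, h2, mul_assoc, mul_assoc, ← mul_add]
  exact Subring.mul_mem _ hc (hP v hm hv r hr hi')

theorem sum_mem_of_star {n : ℕ} {ℓ : ℕ → ℕ} {i i' : Fin n} (hii : (i' : ℕ) = i + 1) {j : ℕ}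
    (hS : SProp ℓ i i' j) (hP : PProp ℓ i i' j) {m : ℕ} (hm : ∀ c < j, m ≤ ℓ c)
    (C : Finset (Fin m → Fin n)) (hC : ∀ v ∈ C, StrictMono v)
    (hst : ∀ v ∈ C, star i i' v ∈ C) :
    ∑ v ∈ C, wcol j v * Gf ℓ j v ∈ symS i i' := by
  intro x
  rw [← sub_eq_zero, Finset.sum_apply, Finset.sum_apply, ← Finset.sum_sub_distrib]
  have key : ∀ v ∈ C, ((∃ r, v r = i) ↔ (∃ r, v r = i')) →
      (wcol j v * Gf ℓ j v) (x ∘ Equiv.swap i i') - (wcol j v * Gf ℓ j v) x = 0 := by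
    intro v hv h
    rw [sub_eq_zero]
    exact Subring.mul_mem _ (wcol_mem hii j (hC v hv) h) (hS v hm (hC v hv) h.1) x
  apply Finset.sum_involution (fun v _ => star i i' v)
  · intro v hv
    by_cases h : (∃ r, v r = i) ∧ (∃ r, v r = i')
    · have e : star i i' v = v := by unfold star; rw [if_pos h]
      rw [e, key v hv ⟨fun _ => h.2, fun _ => h.1⟩]; rfl
    · have e : star i i' v = Equiv.swap i i' ∘ v := by unfold star; rw [if_neg h]
      rw [e]
      by_cases hi : ∃ r, v r = i
      · obtain ⟨r, hr⟩ := hi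
        have := pair_mem hii hP hm (hC v hv) hr (fun h' => h ⟨⟨r, hr⟩, h'⟩) x
        simp only [Pi.add_apply] at this
        linarith
      · by_cases hi2 : ∃ r, v r = i'
        · obtain ⟨r, hr⟩ := hi2
          have hsm := swap_strictMono hii (hC v hv) h
          have := pair_mem hii hP hm hsm (swap_yes hr) (swap_no hi) x
          have ee : Equiv.swap i i' ∘ (Equiv.swap i i' ∘ v) = v := by funext r; simp
          rw [ee] at this
          simp only [Pi.add_apply] at this
          linarith
        · have ee : Equiv.swap i i' ∘ v = v := by
            funext r
            exact Equiv.swap_apply_of_ne_of_ne (fun e => hi ⟨r, e⟩) (fun e => hi2 ⟨r, e⟩)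
          rw [ee, key v hv ⟨fun h => absurd h hi, fun h => absurd h hi2⟩]; rfl
  · intro v hv hne hfix
    apply hne
    by_cases h : (∃ r, v r = i) ∧ (∃ r, v r = i')
    · exact key v hv ⟨fun _ => h.2, fun _ => h.1⟩
    · have e : star i i' v = Equiv.swap i i' ∘ v := by unfold star; rw [if_neg h]
      rw [e] at hfix
      have hne2 : i ≠ i' := by intro e; rw [Fin.ext_iff] at e; omega
      apply key v hv
      constructor
      · rintro ⟨r, hr⟩
        have := congrFun hfix r
        simp [hr] at this; exact absurd this.symm hne2
      · rintro ⟨r, hr⟩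
        have := congrFun hfix r
        simp [hr] at this; exact absurd this hne2
  · intro v hv; exact hst v hv
  · intro v hv; exact star_star _ _ _

end FactorialLR
namespace FactorialLR

theorem SProp_succ {n : ℕ} {ℓ : ℕ → ℕ} (hℓ : Antitone ℓ) {i i' : Fin n} (hii : (i' : ℕ) = i + 1)
    {j : ℕ} (hS : SProp ℓ i i' j) (hP : PProp ℓ i i' j) : SProp ℓ i i' (j + 1) := by
  intro m u hm hu h
  rw [Gf]
  apply sum_mem_of_star hii hS hP (fun c hc => hℓ hc.le)
  · intro v hv; exact (mem_colSet.1 hv).1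
  · intro v hv
    rw [mem_colSet] at hv ⊢
    refine ⟨star_strictMono hii hv.1, ?_⟩
    unfold star
    split_ifs with hb
    · exact hv.2
    · intro r h1 h2
      have hvr := hv.2 r h1 h2
      simp only [Function.comp, Equiv.swap_apply_def]
      split_ifs with e1 e2
      · -- v r = i, need i' ≤ u r
        rw [Fin.le_def]
        rw [e1, Fin.le_def] at hvr
        by_contra hlt
        have hur : u ⟨r, h1⟩ = i := by rw [Fin.ext_iff]; omega
        obtain ⟨s, hs⟩ := h ⟨_, hur⟩
        have hrs : (⟨r, h1⟩ : Fin m) < s := hu.lt_iff_lt.1 (by rw [hur, hs, Fin.lt_def]; omega)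
        have hsl : (s : ℕ) < ℓ j := lt_of_lt_of_le s.2 (hm j (by omega))
        have h3 : v ⟨s, hsl⟩ ≤ i' := by rw [← hs]; exact hv.2 s s.2 hsl
        have h4 : v ⟨r, h2⟩ < v ⟨s, hsl⟩ := hv.1 (by simpa [Fin.lt_def] using hrs)
        apply hb
        refine ⟨⟨_, e1⟩, ⟨⟨s, hsl⟩, ?_⟩⟩
        rw [e1] at h4
        rw [Fin.lt_def] at h4; rw [Fin.le_def] at h3
        rw [Fin.ext_iff]; omega
      · rw [e2] at hvr
        rw [Fin.le_def] at *; omega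
      · exact hvr

/-- bad set -/
noncomputable def Vset {n m : ℕ} (m' : ℕ) (i i' : Fin n) (u : Fin m → Fin n) (r : ℕ) :
    Finset (Fin m' → Fin n) :=
  open Classical in
  (colSet m' u).filter fun v => (∃ h : r < m', v ⟨r, h⟩ = i) ∧ ¬ ∃ s, v s = i'

theorem PProp_succ {n : ℕ} {ℓ : ℕ → ℕ} (hℓ : Antitone ℓ) {i i' : Fin n} (hii : (i' : ℕ) = i + 1)
    {j : ℕ} (hS : SProp ℓ i i' j) (hP : PProp ℓ i i' j) : PProp ℓ i i' (j + 1) := by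
  classical
  intro m u hm hu r hr hi'
  have hne : i ≠ i' := by intro e; rw [Fin.ext_iff] at e; omega
  have hrl : (r : ℕ) < ℓ j := lt_of_lt_of_le r.2 (hm j (by omega))
  have hmm : ∀ c < j, ℓ j ≤ ℓ c := fun c hc => hℓ hc.le
  have huo : ∀ s, s ≠ r → Equiv.swap i i' (u s) = u s := fun s hs =>
    Equiv.swap_apply_of_ne_of_ne (fun e => hs (hu.injective (e.trans hr.symm)))
      (fun e => hi' ⟨s, e⟩)
  set V := Vset (ℓ j) i i' u r with hV
  have memV : ∀ v, v ∈ V ↔ (StrictMono v ∧ Compat v u) ∧ v ⟨r, hrl⟩ = i ∧ ¬ ∃ s, v s = i' := by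
    intro v
    simp only [hV, Vset, Finset.mem_filter, mem_colSet]
    constructor
    · rintro ⟨h1, ⟨h2, h3⟩, h4⟩; exact ⟨h1, h3, h4⟩
    · rintro ⟨h1, h3, h4⟩; exact ⟨h1, ⟨hrl, h3⟩, h4⟩
  have hVsub : V ⊆ colSet (ℓ j) u := Finset.filter_subset _ _
  -- E symmetric
  have hE : ∑ v ∈ colSet (ℓ j) u \ V, wcol j v * Gf ℓ j v ∈ symS i i' := by
    apply sum_mem_of_star hii hS hP hmm
    · intro v hv; exact (mem_colSet.1 (Finset.mem_sdiff.1 hv).1).1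
    · intro v hv
      rw [Finset.mem_sdiff, mem_colSet, memV] at hv
      obtain ⟨⟨hv1, hv2⟩, hv3⟩ := hv
      have hsm := star_strictMono hii hv1
      by_cases hb : (∃ r, v r = i) ∧ (∃ r, v r = i')
      · have e : star i i' v = v := by unfold star; rw [if_pos hb]
        rw [e, Finset.mem_sdiff, mem_colSet, memV]
        exact ⟨⟨hv1, hv2⟩, hv3⟩
      · have e : star i i' v = Equiv.swap i i' ∘ v := by unfold star; rw [if_neg hb]
        rw [e] at hsm ⊢
        have hvri : v ⟨r, hrl⟩ ≠ i := by
          intro h; apply hv3; exact ⟨⟨hv1, hv2⟩, h, fun h' => hb ⟨⟨_, h⟩, h'⟩⟩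
        have hvr := hv2 r r.2 hrl
        have hvri' : v ⟨r, hrl⟩ ≠ i' := by
          intro h; rw [h] at hvr
          have : u ⟨r, r.2⟩ = i := hr
          rw [this, Fin.le_def] at hvr; omega
        rw [Finset.mem_sdiff, mem_colSet, memV]
        refine ⟨⟨hsm, ?_⟩, ?_⟩
        · intro s h1 h2
          have hvs := hv2 s h1 h2
          simp only [Function.comp, Equiv.swap_apply_def]
          split_ifs with e1 e2
          · have hsr : (⟨s, h1⟩ : Fin m) ≠ r := by
              intro e
              apply hvri
              rw [← e1]; congr 1; rw [Fin.ext_iff]; rw [Fin.ext_iff] at e; exact e.symm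
            have h5 : u ⟨s, h1⟩ ≠ i := fun e => hsr (hu.injective (e.trans hr.symm))
            rw [e1] at hvs
            rw [Fin.le_def] at *
            have : (u ⟨s, h1⟩ : ℕ) ≠ i := fun e => h5 (Fin.ext e)
            omega
          · rw [e2] at hvs; rw [Fin.le_def] at *; omega
          · exact hvs
        · rintro ⟨-, h6, -⟩
          apply hvri'
          have := congrArg (Equiv.swap i i') h6
          simpa using this
  have hGu : Gf ℓ (j+1) u = (∑ v ∈ colSet (ℓ j) u \ V, wcol j v * Gf ℓ j v)
      + ∑ v ∈ V, wcol j v * Gf ℓ j v := by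
    rw [Gf, Finset.sum_sdiff hVsub]
  have hstarcol : colSet (ℓ j) (Equiv.swap i i' ∘ u) =
      colSet (ℓ j) u ∪ V.image (fun v => Equiv.swap i i' ∘ v) := by
    ext v
    rw [Finset.mem_union, Finset.mem_image, mem_colSet, mem_colSet]
    constructor
    · rintro ⟨h1, h2⟩
      by_cases hc : Compat v u
      · exact Or.inl ⟨h1, hc⟩
      · right
        have hothers : ∀ s (hs : s < m) (hs' : s < ℓ j), s ≠ r → v ⟨s, hs'⟩ ≤ u ⟨s, hs⟩ := by
          intro s hs hs' hsr
          have := h2 s hs hs'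
          rwa [Function.comp, huo ⟨s, hs⟩ (fun e => hsr (congrArg Fin.val e))] at this
        have hnr : ¬ v ⟨r, hrl⟩ ≤ u r := by
          intro hle
          apply hc
          intro s hs hs'
          by_cases e : s = r
          · subst e; exact hle
          · exact hothers s hs hs' e
        have hvr' := h2 r r.2 hrl
        have hvr : v ⟨r, hrl⟩ = i' := by
          have e : (Equiv.swap i i' ∘ u) ⟨r, r.2⟩ = i' := by simp [hr]
          rw [e] at hvr'
          rw [hr] at hnr
          rw [Fin.le_def] at *; rw [Fin.ext_iff]; omega
        have hni : ¬ ∃ s, v s = i := by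
          rintro ⟨s, hs⟩
          have hsr : s < ⟨r, hrl⟩ := h1.lt_iff_lt.1 (by rw [hs, hvr, Fin.lt_def]; omega)
          rw [Fin.lt_def] at hsr
          simp only at hsr
          have hsm : (s : ℕ) < m := lt_trans hsr r.2
          have h7 := hothers s hsm s.2 hsr.ne
          have h8 : u ⟨s, hsm⟩ < u r := hu (by rw [Fin.lt_def]; exact hsr)
          rw [hr] at h8
          have : v ⟨s, s.2⟩ = i := hs
          rw [this] at h7
          exact absurd (lt_of_le_of_lt h7 h8) (lt_irrefl _)
        refine ⟨Equiv.swap i i' ∘ v, ?_, ?_⟩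
        · rw [memV]
          refine ⟨⟨swap_strictMono hii h1 (fun h => hni h.1), ?_⟩, swap_yes hvr, swap_no hni⟩
          intro s hs hs'
          by_cases e : s = r
          · subst e
            rw [swap_yes hvr]; exact hr.ge
          · have h9 : v ⟨s, hs'⟩ ≠ i' := by
              intro h; exact e (congrArg Fin.val (h1.injective (h.trans hvr.symm)))
            rw [Function.comp, Equiv.swap_apply_of_ne_of_ne (fun h => hni ⟨_, h⟩) h9]
            exact hothers s hs hs' e
        · funext s; simp
    · rintro (⟨h1, h2⟩ | ⟨v', hv', rfl⟩)
      · refine ⟨h1, ?_⟩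
        intro s hs hs'
        have h3 := h2 s hs hs'
        by_cases e : (⟨s, hs⟩ : Fin m) = r
        · have e2 : (Equiv.swap i i' ∘ u) ⟨s, hs⟩ = i' := by rw [e]; simp [hr]
          rw [e2]; rw [e, hr] at h3
          rw [Fin.le_def] at *; omega
        · rw [Function.comp, huo _ e]; exact h3
      · rw [memV] at hv'
        obtain ⟨⟨h1, h2⟩, h3, h4⟩ := hv'
        refine ⟨swap_strictMono hii h1 (fun h => h4 h.2), ?_⟩
        intro s hs hs'
        by_cases e : s = r
        · subst e
          simp [h3, hr]
        · rw [Function.comp, Function.comp, huo ⟨s, hs⟩ (fun h => e (congrArg Fin.val h)),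
            Equiv.swap_apply_of_ne_of_ne (fun h => e (congrArg Fin.val (h1.injective
              (h.trans h3.symm)))) (fun h => h4 ⟨_, h⟩)]
          exact h2 s hs hs'
  have hdisj : Disjoint (colSet (ℓ j) u) (V.image (fun v => Equiv.swap i i' ∘ v)) := by
    rw [Finset.disjoint_right]
    intro v hv hv2
    rw [Finset.mem_image] at hv
    obtain ⟨v', hv', rfl⟩ := hv
    rw [memV] at hv'
    rw [mem_colSet] at hv2
    have h1 := hv2.2 r r.2 hrl
    simp only [Function.comp, hv'.2.1, Equiv.swap_apply_left] at h1
    have : u ⟨r, r.2⟩ = i := hr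
    rw [this, Fin.le_def] at h1
    omega
  have hGs : Gf ℓ (j+1) (Equiv.swap i i' ∘ u) = (∑ v ∈ colSet (ℓ j) u \ V, wcol j v * Gf ℓ j v)
      + ∑ v ∈ V, (wcol j v * Gf ℓ j v +
        wcol j (Equiv.swap i i' ∘ v) * Gf ℓ j (Equiv.swap i i' ∘ v)) := by
    rw [Gf, hstarcol, Finset.sum_union hdisj, Finset.sum_image, Finset.sum_add_distrib, ← add_assoc,
      Finset.sum_sdiff hVsub]
    intro a _ b _ hab
    funext s
    have := congrFun hab s
    simpa using this
  rw [hGu, hGs]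
  set E := ∑ v ∈ colSet (ℓ j) u \ V, wcol j v * Gf ℓ j v
  set β : ℤ := (i : ℤ) + (j + 1 : ℕ) - r with hβ
  have : (fun x : Fin n → ℤ => x i - β) * (E + ∑ v ∈ V, wcol j v * Gf ℓ j v)
      + (fun x : Fin n → ℤ => x i' - (β + 1)) * (E + ∑ v ∈ V, (wcol j v * Gf ℓ j v +
        wcol j (Equiv.swap i i' ∘ v) * Gf ℓ j (Equiv.swap i i' ∘ v)))
      = (fun x : Fin n → ℤ => x i + x i' - (2 * β + 1)) * E + ∑ v ∈ V,
        ((fun x : Fin n → ℤ => x i - β) * (wcol j v * Gf ℓ j v) +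
        (fun x : Fin n → ℤ => x i' - (β + 1)) * (wcol j v * Gf ℓ j v +
        wcol j (Equiv.swap i i' ∘ v) * Gf ℓ j (Equiv.swap i i' ∘ v))) := by
    conv_rhs => rw [Finset.sum_add_distrib, ← Finset.mul_sum, ← Finset.mul_sum]
    have : (fun x : Fin n → ℤ => x i + x i' - (2 * β + 1)) = (fun x : Fin n → ℤ => x i - β) +
        (fun x : Fin n → ℤ => x i' - (β + 1)) := by funext x; simp; ring
    rw [this]; ring
  rw [this]
  apply Subring.add_mem _ (Subring.mul_mem _ (add_pair_mem _) hE)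
  apply Subring.sum_mem
  intro v hv
  rw [memV] at hv
  obtain ⟨⟨hv1, hv2⟩, hv3, hv4⟩ := hv
  have hQ := pair_mem hii hP hmm hv1 hv3 hv4
  obtain ⟨c, hc, hw1, hw2⟩ := wcol_fact hii j hv1 hv3 hv4
  have hg : Gf ℓ j (Equiv.swap i i' ∘ v) ∈ symS i i' :=
    hS _ hmm (swap_strictMono hii hv1 (fun h => hv4 h.2))
      (fun _ => ⟨⟨r, hrl⟩, by simp [hv3]⟩)
  set Q := wcol j v * Gf ℓ j v + wcol j (Equiv.swap i i' ∘ v) * Gf ℓ j (Equiv.swap i i' ∘ v) with hQd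
  have e : (fun x : Fin n → ℤ => x i - β) * (wcol j v * Gf ℓ j v) +
        (fun x : Fin n → ℤ => x i' - (β + 1)) * Q
      = (fun x : Fin n → ℤ => x i + x i' - (2 * β + 1)) * Q
        - (fun x : Fin n → ℤ => (x i - β) * (x i' - β)) * (c * Gf ℓ j (Equiv.swap i i' ∘ v)) := by
    have h0 : wcol j v * Gf ℓ j v
        = Q - wcol j (Equiv.swap i i' ∘ v) * Gf ℓ j (Equiv.swap i i' ∘ v) := by rw [hQd]; ring
    rw [h0, hw2]
    funext x
    simp only [Pi.add_apply, Pi.mul_apply, Pi.sub_apply, hβ]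
    push_cast
    ring
  rw [e]
  exact Subring.sub_mem _ (Subring.mul_mem _ (add_pair_mem _) hQ)
    (Subring.mul_mem _ (mul_pair_mem _) (Subring.mul_mem _ hc hg))

theorem SP {n : ℕ} {ℓ : ℕ → ℕ} (hℓ : Antitone ℓ) {i i' : Fin n} (hii : (i' : ℕ) = i + 1)
    (j : ℕ) : SProp ℓ i i' j ∧ PProp ℓ i i' j := by
  induction j with
  | zero =>
    constructor
    · intro m u _ _ _; exact Subring.one_mem _
    · intro m u _ _ r _ _
      intro x; simp [Gf]; ring
  | succ j ih => exact ⟨SProp_succ hℓ hii ih.1 ih.2, PProp_succ hℓ hii ih.1 ih.2⟩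

end FactorialLR

namespace FactorialLR

def Addable (μ : YoungDiagram) (t : ℕ) : Prop := ∀ s < t, μ.rowLen t < μ.rowLen s

open Classical in
noncomputable def addRow (μ : YoungDiagram) (t : ℕ) : YoungDiagram :=
  if h : Addable μ t then
    ⟨insert (t, μ.rowLen t) μ.cells, by
      intro a b hab ha
      simp only [Finset.coe_insert, Set.mem_insert_iff, Finset.mem_coe, YoungDiagram.mem_cells] at ha ⊢
      rcases ha with rfl | ha
      · obtain ⟨b1, b2⟩ := b
        obtain ⟨h1, h2⟩ := Prod.mk_le_mk.1 hab
        rcases h1.lt_or_eq with h3 | h3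
        · right; rw [YoungDiagram.mem_iff_lt_rowLen]
          exact lt_of_le_of_lt h2 (h _ h3)
        · subst h3
          rcases h2.lt_or_eq with h4 | h4
          · right; rw [YoungDiagram.mem_iff_lt_rowLen]; exact h4
          · left; rw [h4]
      · right; exact μ.isLowerSet hab ha⟩
  else μ

theorem mem_addRow {μ : YoungDiagram} {t : ℕ} (h : Addable μ t) {c : ℕ × ℕ} :
    c ∈ addRow μ t ↔ c = (t, μ.rowLen t) ∨ c ∈ μ := by
  unfold addRow
  rw [dif_pos h, ← YoungDiagram.mem_cells]
  simp

theorem cells_addRow {μ : YoungDiagram} {t : ℕ} (h : Addable μ t) :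
    (addRow μ t).cells = insert (t, μ.rowLen t) μ.cells := by
  unfold addRow
  rw [dif_pos h]

theorem notMem_row (μ : YoungDiagram) (t : ℕ) : (t, μ.rowLen t) ∉ μ := by
  rw [YoungDiagram.mem_iff_lt_rowLen]; exact lt_irrefl _

theorem card_addRow {μ : YoungDiagram} {t : ℕ} (h : Addable μ t) :
    (addRow μ t).card = μ.card + 1 := by
  unfold YoungDiagram.card
  rw [cells_addRow h, Finset.card_insert_of_notMem (by simpa using notMem_row μ t)]

theorem rowLen_eq_of {μ : YoungDiagram} {s k : ℕ} (h : ∀ j, (s, j) ∈ μ ↔ j < k) :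
    μ.rowLen s = k := by
  apply le_antisymm
  · by_contra hlt
    rw [not_le] at hlt
    exact lt_irrefl _ ((h k).1 (YoungDiagram.mem_iff_lt_rowLen.2 hlt))
  · by_contra hlt
    rw [not_le] at hlt
    exact lt_irrefl _ (YoungDiagram.mem_iff_lt_rowLen.1 ((h _).2 hlt))

theorem rowLen_addRow {μ : YoungDiagram} {t : ℕ} (h : Addable μ t) (s : ℕ) :
    (addRow μ t).rowLen s = if s = t then μ.rowLen t + 1 else μ.rowLen s := by
  apply rowLen_eq_of
  intro j
  rw [mem_addRow h, YoungDiagram.mem_iff_lt_rowLen, Prod.mk.injEq]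
  split_ifs with e
  · subst e; omega
  · simp [e]

theorem covers_addRow {μ : YoungDiagram} {t : ℕ} (h : Addable μ t) : Covers μ (addRow μ t) := by
  refine ⟨?_, card_addRow h⟩
  intro c hc
  exact (mem_addRow h).2 (Or.inr hc)

theorem stepRow_addRow {μ : YoungDiagram} {t : ℕ} (h : Addable μ t) :
    stepRow μ (addRow μ t) = t := by
  unfold stepRow
  rw [cells_addRow h]
  have : insert (t, μ.rowLen t) μ.cells \ μ.cells = {(t, μ.rowLen t)} := by
    ext c
    simp only [Finset.mem_sdiff, Finset.mem_insert, Finset.mem_singleton]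
    constructor
    · rintro ⟨h1 | h1, h2⟩
      · exact h1
      · exact absurd h1 h2
    · rintro rfl
      exact ⟨Or.inl rfl, by simpa using notMem_row μ t⟩
  rw [this]; simp

theorem covers_exists {μ τ : YoungDiagram} (h : Covers μ τ) :
    ∃ t, Addable μ t ∧ τ = addRow μ t := by
  obtain ⟨h1, h2⟩ := h
  have hsub : μ.cells ⊆ τ.cells := h1
  have hc : (τ.cells \ μ.cells).card = 1 := by
    rw [Finset.card_sdiff_of_subset hsub]; unfold YoungDiagram.card at h2; omega
  obtain ⟨⟨t, k⟩, hk⟩ := Finset.card_eq_one.1 hc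
  have hins : ∀ c, c ∈ τ ↔ c = (t, k) ∨ c ∈ μ := by
    intro c
    have := Finset.ext_iff.1 hk c
    simp only [Finset.mem_sdiff, YoungDiagram.mem_cells, Finset.mem_singleton] at this
    constructor
    · intro hc
      by_cases hm : c ∈ μ
      · exact Or.inr hm
      · exact Or.inl (this.1 ⟨hc, hm⟩)
    · rintro (e | e)
      · exact (this.2 e).1
      · exact h1 e
  have hnot : (t, k) ∉ μ := by
    have := (Finset.ext_iff.1 hk (t, k)).2 (by simp)
    simpa using (Finset.mem_sdiff.1 this).2
  have hkr : k = μ.rowLen t := by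
    apply le_antisymm
    · by_contra hlt
      rw [not_le] at hlt
      have : (t, μ.rowLen t) ∈ τ := τ.isLowerSet (Prod.mk_le_mk.2 ⟨le_refl t, hlt.le⟩)
        ((hins _).2 (Or.inl rfl))
      rcases (hins _).1 this with e | e
      · rw [Prod.mk.injEq] at e; omega
      · exact notMem_row _ _ e
    · by_contra hlt
      rw [not_le] at hlt
      exact hnot (YoungDiagram.mem_iff_lt_rowLen.2 hlt)
  subst hkr
  have hadd : Addable μ t := by
    intro s hs
    have : (s, μ.rowLen t) ∈ τ := τ.isLowerSet (Prod.mk_le_mk.2 ⟨hs.le, le_refl _⟩)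
        ((hins _).2 (Or.inl rfl))
    rcases (hins _).1 this with e | e
    · rw [Prod.mk.injEq] at e; omega
    · exact YoungDiagram.mem_iff_lt_rowLen.1 e
  refine ⟨t, hadd, ?_⟩
  ext c
  rw [YoungDiagram.mem_cells, YoungDiagram.mem_cells, hins, mem_addRow hadd]

theorem covers_iff {μ τ : YoungDiagram} {t : ℕ} :
    (Covers μ τ ∧ stepRow μ τ = t) ↔ (Addable μ t ∧ τ = addRow μ t) := by
  constructor
  · rintro ⟨h, rfl⟩
    obtain ⟨t, h1, rfl⟩ := covers_exists h
    rw [stepRow_addRow h1]; exact ⟨h1, rfl⟩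
  · rintro ⟨h, rfl⟩
    exact ⟨covers_addRow h, stepRow_addRow h⟩

theorem colLen_le_iff {μ : YoungDiagram} {n : ℕ} :
    μ.colLen 0 ≤ n ↔ ∀ s, n ≤ s → μ.rowLen s = 0 := by
  constructor
  · intro h s hs
    by_contra hne
    have : (s, 0) ∈ μ := YoungDiagram.mem_iff_lt_rowLen.2 (by omega)
    rw [YoungDiagram.mem_iff_lt_colLen] at this
    omega
  · intro h
    by_contra hlt
    rw [not_le] at hlt
    have : (n, 0) ∈ μ := YoungDiagram.mem_iff_lt_colLen.2 hlt
    rw [YoungDiagram.mem_iff_lt_rowLen, h n le_rfl] at this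
    omega

theorem addRow_rows {μ : YoungDiagram} {n t : ℕ} (h : Addable μ t) (ht : t < n)
    (hμ : μ.colLen 0 ≤ n) : (addRow μ t).colLen 0 ≤ n := by
  rw [colLen_le_iff] at hμ ⊢
  intro s hs
  rw [rowLen_addRow h, if_neg (by omega)]
  exact hμ s hs

theorem le_iff_rowLen {μ ρ : YoungDiagram} : μ ≤ ρ ↔ ∀ s, μ.rowLen s ≤ ρ.rowLen s := by
  constructor
  · intro h s
    by_contra hlt
    rw [not_le] at hlt
    have : (s, ρ.rowLen s) ∈ μ := YoungDiagram.mem_iff_lt_rowLen.2 hlt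
    exact notMem_row _ _ (h this)
  · rintro h ⟨a, b⟩ hc
    rw [YoungDiagram.mem_iff_lt_rowLen] at *
    exact lt_of_lt_of_le hc (h a)

theorem le_rows {μ ρ : YoungDiagram} {n : ℕ} (h : μ ≤ ρ) (hρ : ρ.colLen 0 ≤ n) :
    μ.colLen 0 ≤ n := by
  rw [colLen_le_iff] at *
  intro s hs
  have := le_iff_rowLen.1 h s
  rw [hρ s hs] at this; omega

theorem card_eq_sum {μ : YoungDiagram} {n : ℕ} (h : μ.colLen 0 ≤ n) :
    μ.card = ∑ t : Fin n, μ.rowLen t := by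
  unfold YoungDiagram.card
  have h1 : μ.cells = (Finset.range n).biUnion fun t => μ.row t := by
    ext ⟨a, b⟩
    simp only [YoungDiagram.mem_cells, Finset.mem_biUnion, Finset.mem_range]
    constructor
    · intro hc
      refine ⟨a, ?_, by simp [YoungDiagram.row, hc]⟩
      by_contra hlt
      rw [YoungDiagram.mem_iff_lt_rowLen, colLen_le_iff.1 h a (by omega)] at hc
      omega
    · rintro ⟨t, _, ht⟩
      simp [YoungDiagram.row] at ht; exact ht.1
  rw [h1, Finset.card_biUnion, Finset.sum_range]
  · apply Finset.sum_congr rfl; intro t _; rw [YoungDiagram.rowLen_eq_card]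
  · intro a _ b _ hab
    apply Finset.disjoint_left.2
    rintro ⟨c, d⟩ h1 h2
    simp [YoungDiagram.row] at h1 h2
    omega

theorem card_transpose' (μ : YoungDiagram) : μ.transpose.card = μ.card := by
  unfold YoungDiagram.card
  simp [YoungDiagram.transpose]

theorem transpose_le {μ ρ : YoungDiagram} : μ.transpose ≤ ρ.transpose ↔ μ ≤ ρ :=
  YoungDiagram.transpose_le_iff

theorem covers_transpose {μ τ : YoungDiagram} :
    Covers μ.transpose τ.transpose ↔ Covers μ τ := by
  unfold Covers
  rw [transpose_le, card_transpose', card_transpose']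

/-- existence of a cover inside. -/
theorem exists_cover {μ ρ : YoungDiagram} (h : μ ≤ ρ) (hne : μ ≠ ρ) :
    ∃ t, Addable μ t ∧ addRow μ t ≤ ρ := by
  classical
  have hex : ∃ t, μ.rowLen t < ρ.rowLen t := by
    by_contra hcon
    push Not at hcon
    exact hne (le_antisymm h (le_iff_rowLen.2 hcon))
  refine ⟨Nat.find hex, ?_, ?_⟩
  · intro s hs
    have h1 := Nat.find_min hex hs
    have h2 := Nat.find_spec hex
    have h3 := ρ.rowLen_anti _ _ hs.le
    omega
  · have hadd : Addable μ (Nat.find hex) := by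
      intro s hs
      have h1 := Nat.find_min hex hs
      have h2 := Nat.find_spec hex
      have h3 := ρ.rowLen_anti _ _ hs.le
      omega
    rw [le_iff_rowLen]
    intro s
    rw [rowLen_addRow hadd]
    split_ifs with e
    · rw [e]; exact Nat.find_spec hex
    · exact le_iff_rowLen.1 h s

theorem finite_le (ρ : YoungDiagram) : {ν : YoungDiagram | ν ≤ ρ}.Finite := by
  apply Set.Finite.of_finite_image (f := YoungDiagram.cells)
  · apply (Finset.finite_toSet ρ.cells.powerset).subset
    rintro _ ⟨ν, hν, rfl⟩
    simp only [Finset.coe_powerset, Set.mem_preimage, Set.mem_powerset_iff, Finset.coe_subset]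
    exact hν
  · intro a _ b _ h
    exact YoungDiagram.ext h

noncomputable def below (ρ : YoungDiagram) : Finset YoungDiagram := (finite_le ρ).toFinset

theorem mem_below {ν ρ : YoungDiagram} : ν ∈ below ρ ↔ ν ≤ ρ := by simp [below]

theorem card_mono {ν ρ : YoungDiagram} (h : ν ≤ ρ) : ν.card ≤ ρ.card := Finset.card_le_card h

theorem eq_of_card {ν ρ : YoungDiagram} (h : ν ≤ ρ) (hc : ρ.card ≤ ν.card) : ν = ρ :=
  YoungDiagram.ext (Finset.eq_of_subset_of_card_le h hc)

end FactorialLR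

namespace FactorialLR

def ff (x : ℤ) (k : ℕ) : ℤ := ∏ m ∈ Finset.range k, (x - m)

theorem ff_succ (x : ℤ) (k : ℕ) : ff x (k + 1) = ff x k * (x - k) := by
  unfold ff; rw [Finset.prod_range_succ]

theorem ff_zero_of_lt {a k : ℕ} (h : a < k) : ff (a : ℤ) k = 0 := by
  unfold ff
  exact Finset.prod_eq_zero (Finset.mem_range.2 h) (by simp)

theorem ff_self (k : ℕ) : ff (k : ℤ) k = (k.factorial : ℤ) := by
  induction k with
  | zero => simp [ff]
  | succ k ih =>
    unfold ff at *
    rw [Finset.prod_range_succ', Nat.factorial_succ]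
    push_cast at *
    rw [← ih]
    simp only [add_sub_add_right_eq_sub, sub_zero]
    ring

def Bf {n : ℕ} (k : Fin n → ℕ) : (Fin n → ℤ) → ℤ := fun x => ∏ t, ff (x t) (k t)

noncomputable def asym {n : ℕ} (p : (Fin n → ℤ) → ℤ) : (Fin n → ℤ) → ℤ :=
  fun x => ∑ σ : Equiv.Perm (Fin n), (Equiv.Perm.sign σ : ℤ) * p (x ∘ σ)

theorem asym_add {n : ℕ} (p q : (Fin n → ℤ) → ℤ) : asym (p + q) = asym p + asym q := by
  funext x; simp [asym, mul_add, Finset.sum_add_distrib]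

theorem asym_smul {n : ℕ} (a : ℤ) (p : (Fin n → ℤ) → ℤ) :
    asym (fun x => a * p x) = fun x => a * asym p x := by
  funext x; simp only [asym, Finset.mul_sum]
  apply Finset.sum_congr rfl; intro σ _; ring

theorem asym_sum {n : ℕ} {ι : Type*} (s : Finset ι) (p : ι → (Fin n → ℤ) → ℤ) :
    asym (∑ i ∈ s, p i) = ∑ i ∈ s, asym (p i) := by
  classical
  induction s using Finset.induction_on with
  | empty => funext x; simp [asym]
  | insert a s ha ih => rw [Finset.sum_insert ha, Finset.sum_insert ha, asym_add, ih]

theorem asym_zero {n : ℕ} {i i' : Fin n} (hne : i ≠ i') {p : (Fin n → ℤ) → ℤ}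
    (hp : p ∈ symS i i') : asym p = 0 := by
  funext x
  apply Finset.sum_involution (fun σ _ => σ * Equiv.swap i i')
  · intro σ _
    have : p (x ∘ ⇑(σ * Equiv.swap i i')) = p (x ∘ σ) := hp (x ∘ σ)
    rw [this, Equiv.Perm.sign_mul, Equiv.Perm.sign_swap hne]
    simp
  · intro σ _ _ h
    have : Equiv.swap i i' = 1 := by simpa using h
    exact hne (Equiv.swap_eq_one_iff.1 this)
  · intro σ _; exact Finset.mem_univ _
  · intro σ _; simp [mul_assoc]

theorem asym_mul_sym {n : ℕ} {s p : (Fin n → ℤ) → ℤ}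
    (hs : ∀ (σ : Equiv.Perm (Fin n)) x, s (x ∘ σ) = s x) : asym (s * p) = s * asym p := by
  funext x
  simp only [asym, Pi.mul_apply, Finset.mul_sum]
  apply Finset.sum_congr rfl; intro σ _; rw [hs]; ring

def kx (n : ℕ) (μ : YoungDiagram) : Fin n → ℕ := fun t => μ.rowLen t + (n - 1 - t)

theorem kx_strictAnti (n : ℕ) (μ : YoungDiagram) : StrictAnti (kx n μ) := by
  intro a b hab
  have := μ.rowLen_anti _ _ (le_of_lt (Fin.lt_def.1 hab))
  have := b.2
  have := Fin.lt_def.1 hab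
  unfold kx; omega

noncomputable def Af (n : ℕ) (μ : YoungDiagram) : (Fin n → ℤ) → ℤ := asym (Bf (kx n μ))

theorem Bf_step {n : ℕ} (k : Fin n → ℕ) (t : Fin n) (x : Fin n → ℤ) :
    x t * Bf k x = Bf (Function.update k t (k t + 1)) x + (k t : ℤ) * Bf k x := by
  unfold Bf
  rw [← Finset.mul_prod_erase _ _ (Finset.mem_univ t),
    ← Finset.mul_prod_erase _ (fun s => ff (x s) (Function.update k t (k t + 1) s))
      (Finset.mem_univ t)]
  have : ∏ s ∈ Finset.univ.erase t, ff (x s) (Function.update k t (k t + 1) s)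
      = ∏ s ∈ Finset.univ.erase t, ff (x s) (k s) := by
    apply Finset.prod_congr rfl
    intro s hs
    rw [Function.update_of_ne (Finset.ne_of_mem_erase hs)]
  rw [this, Function.update_self, ff_succ]
  ring

theorem kx_addRow {n : ℕ} {μ : YoungDiagram} {t : Fin n} (h : Addable μ t) :
    Function.update (kx n μ) t (kx n μ t + 1) = kx n (addRow μ t) := by
  funext s
  unfold kx
  rw [rowLen_addRow h]
  by_cases e : s = t
  · subst e; simp; omega
  · rw [Function.update_of_ne e, if_neg (fun h => e (Fin.ext h))]

theorem Bf_symm {n : ℕ} {k : Fin n → ℕ} {i i' : Fin n} (h : k i = k i') : Bf k ∈ symS i i' := by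
  intro x
  unfold Bf
  rw [← Equiv.prod_comp (Equiv.swap i i') (fun t => ff (x t) (k t))]
  apply Finset.prod_congr rfl
  intro t _
  have : k (Equiv.swap i i' t) = k t := by
    rw [Equiv.swap_apply_def]; split_ifs with h1 h2
    · rw [h1, h]
    · rw [h2, h]
    · rfl
  rw [this]; rfl

theorem not_addable {n : ℕ} {μ : YoungDiagram} {t : Fin n} (h : ¬ Addable μ t) :
    ∃ i : Fin n, (t : ℕ) = i + 1 ∧
      Bf (Function.update (kx n μ) t (kx n μ t + 1)) ∈ symS i t := by
  unfold Addable at h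
  push Not at h
  obtain ⟨s, hs, hle⟩ := h
  have ht := t.2
  refine ⟨⟨t - 1, by omega⟩, ?_, ?_⟩
  · simp only; omega
  · apply Bf_symm
    have h1 : μ.rowLen (t - 1) ≤ μ.rowLen s := μ.rowLen_anti _ _ (by omega)
    have h2 : μ.rowLen t ≤ μ.rowLen (t - 1) := μ.rowLen_anti _ _ (by omega)
    rw [Function.update_self, Function.update_of_ne (by rw [Ne, Fin.ext_iff]; simp only; omega)]
    unfold kx
    simp only
    omega

/-- evaluation point -/
def pt (n : ℕ) (ρ : YoungDiagram) : Fin n → ℤ := fun t => (kx n ρ t : ℤ)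

theorem Af_pt_zero {n : ℕ} {μ ρ : YoungDiagram} (hμ : μ.colLen 0 ≤ n) (h : ¬ μ ≤ ρ) :
    Af n μ (pt n ρ) = 0 := by
  apply Finset.sum_eq_zero
  intro σ _
  by_contra hne
  apply h
  have hall : ∀ t, kx n μ t ≤ kx n ρ (σ t) := by
    intro t
    by_contra hlt
    rw [not_le] at hlt
    apply hne
    have : Bf (kx n μ) (pt n ρ ∘ σ) = 0 :=
      Finset.prod_eq_zero (Finset.mem_univ t) (ff_zero_of_lt hlt)
    rw [this, mul_zero]
  rw [le_iff_rowLen]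
  intro s
  by_cases hs : s < n
  · set t : Fin n := ⟨s, hs⟩
    have hex : ∃ a ≤ t, t ≤ σ a := by
      by_contra hcon
      push Not at hcon
      have : (Finset.Iic t).card ≤ (Finset.Iio t).card := by
        apply Finset.card_le_card_of_injOn σ
        · intro a ha
          simpa using hcon a (by simpa using ha)
        · exact σ.injective.injOn
      simp at this
    obtain ⟨a, ha, hb⟩ := hex
    have h1 := hall a
    have h2 := (kx_strictAnti n μ).antitone ha
    have h3 := (kx_strictAnti n ρ).antitone hb
    have h4 : kx n μ t ≤ kx n ρ t := by omega
    simp only [kx, t] at h4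
    omega
  · rw [colLen_le_iff.1 hμ s (by omega)]; omega

def facp (n : ℕ) (ρ : YoungDiagram) : ℤ := ∏ t, ((kx n ρ t).factorial : ℤ)

theorem Af_pt_self (n : ℕ) (ρ : YoungDiagram) : Af n ρ (pt n ρ) = facp n ρ := by
  have h1 : Af n ρ (pt n ρ) = ∑ σ : Equiv.Perm (Fin n), (Equiv.Perm.sign σ : ℤ) *
    Bf (kx n ρ) (pt n ρ ∘ σ) := rfl
  rw [h1, Finset.sum_eq_single 1]
  · simp only [Equiv.Perm.sign_one, Units.val_one, one_mul, facp]
    apply Finset.prod_congr rfl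
    intro t _
    exact ff_self _
  · intro σ _ hσ
    by_contra hne
    apply hσ
    have hall : ∀ t, σ t ≤ t := by
      intro t
      by_contra hlt
      rw [not_le] at hlt
      apply hne
      have h3 := kx_strictAnti n ρ hlt
      have : Bf (kx n ρ) (pt n ρ ∘ σ) = 0 :=
        Finset.prod_eq_zero (Finset.mem_univ t) (ff_zero_of_lt h3)
      rw [this, mul_zero]
    ext t
    have : ∀ m (hm : m < n), σ ⟨m, hm⟩ = ⟨m, hm⟩ := by
      intro m
      induction m using Nat.strong_induction_on with
      | _ m ih =>
        intro hm
        by_contra hne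
        have hlt : σ ⟨m, hm⟩ < ⟨m, hm⟩ := lt_of_le_of_ne (hall _) hne
        have h5 := ih (σ ⟨m, hm⟩) hlt (σ ⟨m, hm⟩).2
        exact hne (σ.injective h5)
    rw [this t t.2]; rfl
  · intro h; exact absurd (Finset.mem_univ _) h

theorem Af_step {n : ℕ} (μ : YoungDiagram) (t : Fin n) :
    asym (Bf (Function.update (kx n μ) t (kx n μ t + 1))) =
      open Classical in if Addable μ t then Af n (addRow μ t) else 0 := by
  split_ifs with h
  · rw [kx_addRow h]; rfl
  · obtain ⟨i, hi, hs⟩ := not_addable h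
    exact asym_zero (by intro e; rw [e] at hi; omega) hs

open Classical in
theorem pieri_raw {n : ℕ} (μ : YoungDiagram) (x : Fin n → ℤ) :
    (∑ t, x t) * Af n μ x = (∑ t, (kx n μ t : ℤ)) * Af n μ x +
      ∑ t : Fin n, if Addable μ t then Af n (addRow μ t) x else 0 := by
  have h1 : (fun x : Fin n → ℤ => ∑ t, x t) * Af n μ =
      asym ((fun x : Fin n → ℤ => ∑ t, x t) * Bf (kx n μ)) := by
    rw [asym_mul_sym]; rfl
    intro σ x
    exact Equiv.sum_comp σ x
  have h2 : (fun x : Fin n → ℤ => ∑ t, x t) * Bf (kx n μ) =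
      ∑ t, (Bf (Function.update (kx n μ) t (kx n μ t + 1)) +
        fun x => (kx n μ t : ℤ) * Bf (kx n μ) x) := by
    funext x
    simp only [Pi.mul_apply, Finset.sum_mul, Finset.sum_apply, Pi.add_apply]
    apply Finset.sum_congr rfl
    intro t _; exact Bf_step _ _ _
  have h3 := congrFun h1 x
  rw [h2, asym_sum] at h3
  simp only [Pi.mul_apply, Finset.sum_apply, asym_add, Pi.add_apply, asym_smul, Af_step,
    Finset.sum_add_distrib] at h3
  rw [h3, add_comm, Finset.sum_mul]
  congr 1
  apply Finset.sum_congr rfl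
  intro t _
  split_ifs <;> rfl

theorem pieri {n : ℕ} {μ ρ : YoungDiagram} (hμ : μ.colLen 0 ≤ n) (hρ : ρ.colLen 0 ≤ n) :
    ((ρ.card : ℤ) - μ.card) * Af n μ (pt n ρ) =
      open Classical in ∑ τ ∈ (below ρ).filter (Covers μ), Af n τ (pt n ρ) := by
  classical
  have h := pieri_raw μ (pt n ρ)
  have hs : ∀ κ : YoungDiagram, κ.colLen 0 ≤ n →
      ∑ t, (kx n κ t : ℤ) = κ.card + ∑ t : Fin n, ((n - 1 - t : ℕ) : ℤ) := by
    intro κ hκ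
    rw [card_eq_sum hκ, Nat.cast_sum, ← Finset.sum_add_distrib]
    apply Finset.sum_congr rfl; intro t _; unfold kx; push_cast; ring
  have h1 : ∑ t, pt n ρ t = ρ.card + ∑ t : Fin n, ((n - 1 - t : ℕ) : ℤ) := hs ρ hρ
  rw [h1, hs μ hμ] at h
  have h2 : (∑ t : Fin n, if Addable μ t then Af n (addRow μ t) (pt n ρ) else 0)
      = ∑ τ ∈ (below ρ).filter (Covers μ), Af n τ (pt n ρ) := by
    rw [← Finset.sum_filter]
    symm
    have hinj : Set.InjOn (fun t : Fin n => addRow μ t)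
        ((Finset.univ.filter fun t : Fin n => Addable μ t : Finset (Fin n)) : Set (Fin n)) := by
      intro a ha b hb hab
      simp only [Finset.coe_filter, Finset.mem_univ, true_and, Set.mem_setOf_eq] at ha hb
      have e := congrArg (stepRow μ) hab
      simp only [stepRow_addRow ha, stepRow_addRow hb] at e
      exact Fin.ext e
    rw [← Finset.sum_image (f := fun τ => Af n τ (pt n ρ)) hinj]
    apply Finset.sum_subset
    · intro τ hτ
      rw [Finset.mem_filter, mem_below] at hτ
      obtain ⟨t, ht, rfl⟩ := covers_exists hτ.2
      have htn : t < n := by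
        by_contra hlt
        have h5 := le_iff_rowLen.1 hτ.1 t
        rw [rowLen_addRow ht, if_pos rfl, colLen_le_iff.1 hρ t (by omega)] at h5
        omega
      rw [Finset.mem_image]
      exact ⟨⟨t, htn⟩, by simpa using ht, rfl⟩
    · intro τ hτ hn
      rw [Finset.mem_image] at hτ
      obtain ⟨t, ht, rfl⟩ := hτ
      simp only [Finset.mem_filter, Finset.mem_univ, true_and] at ht
      apply Af_pt_zero (addRow_rows ht t.2 hμ)
      intro hle
      apply hn
      rw [Finset.mem_filter, mem_below]
      exact ⟨hle, covers_addRow ht⟩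
  rw [h2] at h
  linarith

/-- normalised values -/
noncomputable def gq (n : ℕ) (μ ρ : YoungDiagram) : ℚ := (Af n μ (pt n ρ) : ℚ) / (facp n ρ : ℚ)

theorem facp_pos (n : ℕ) (ρ : YoungDiagram) : 0 < (facp n ρ : ℚ) := by
  unfold facp
  push_cast
  apply Finset.prod_pos
  intro t _
  exact_mod_cast Nat.factorial_pos _

theorem gq_self (n : ℕ) (ρ : YoungDiagram) : gq n ρ ρ = 1 := by
  unfold gq; rw [Af_pt_self]; exact div_self (facp_pos n ρ).ne'

theorem gq_zero {n : ℕ} {μ ρ : YoungDiagram} (hμ : μ.colLen 0 ≤ n) (h : ¬ μ ≤ ρ) :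
    gq n μ ρ = 0 := by
  unfold gq; rw [Af_pt_zero hμ h]; simp

open Classical in
theorem gq_rec {n : ℕ} {μ ρ : YoungDiagram} (hμ : μ.colLen 0 ≤ n) (hρ : ρ.colLen 0 ≤ n) :
    ((ρ.card : ℚ) - μ.card) * gq n μ ρ = ∑ τ ∈ (below ρ).filter (Covers μ), gq n τ ρ := by
  have h := pieri hμ hρ
  have h' : ((ρ.card : ℚ) - μ.card) * (Af n μ (pt n ρ) : ℚ) =
      ∑ τ ∈ (below ρ).filter (Covers μ), (Af n τ (pt n ρ) : ℚ) := by exact_mod_cast h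
  unfold gq
  rw [← Finset.sum_div, ← h']; ring

theorem gq_pos {n : ℕ} {ρ : YoungDiagram} (hρ : ρ.colLen 0 ≤ n) :
    ∀ (d : ℕ) (μ : YoungDiagram), μ ≤ ρ → ρ.card = μ.card + d → 0 < gq n μ ρ := by
  classical
  intro d
  induction d with
  | zero =>
    intro μ hle hc
    rw [eq_of_card hle (by omega), gq_self]; norm_num
  | succ d ih =>
    intro μ hle hc
    have h := gq_rec (le_rows hle hρ) hρ
    have hpos : 0 < ∑ τ ∈ (below ρ).filter (Covers μ), gq n τ ρ := by
      apply Finset.sum_pos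
      · intro τ hτ
        rw [Finset.mem_filter, mem_below] at hτ
        apply ih τ hτ.1
        have := hτ.2.2; omega
      · obtain ⟨t, h1, h2⟩ := exists_cover hle (by rintro rfl; omega)
        exact ⟨_, Finset.mem_filter.2 ⟨mem_below.2 h2, covers_addRow h1⟩⟩
    rw [← h, hc] at hpos
    push_cast at hpos
    have : (0:ℚ) < d + 1 := by positivity
    have e : ((μ.card : ℚ) + (d + 1) - μ.card) = d + 1 := by ring
    rw [e] at hpos
    exact (pos_iff_pos_of_mul_pos hpos).1 this

theorem gq_transpose {n : ℕ} {ρ : YoungDiagram} (hρ : ρ.colLen 0 ≤ n)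
    (hρ' : ρ.transpose.colLen 0 ≤ n) :
    ∀ (d : ℕ) (μ : YoungDiagram), μ ≤ ρ → ρ.card = μ.card + d →
      gq n μ.transpose ρ.transpose = gq n μ ρ := by
  classical
  intro d
  induction d with
  | zero =>
    intro μ hle hc
    rw [eq_of_card hle (by omega), gq_self, gq_self]
  | succ d ih =>
    intro μ hle hc
    have h := gq_rec (le_rows hle hρ) hρ
    have h' := gq_rec (le_rows (transpose_le.2 hle) hρ') hρ'
    rw [card_transpose', card_transpose'] at h'
    have e : ∑ τ ∈ (below ρ.transpose).filter (Covers μ.transpose), gq n τ ρ.transpose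
        = ∑ τ ∈ (below ρ).filter (Covers μ), gq n τ ρ := by
      symm
      apply Finset.sum_bij (fun τ _ => τ.transpose)
      · intro τ hτ
        rw [Finset.mem_filter, mem_below] at hτ ⊢
        rw [transpose_le, covers_transpose]; exact hτ
      · intro a _ b _ hab
        simpa using hab
      · intro τ hτ
        refine ⟨τ.transpose, ?_, by simp⟩
        rw [Finset.mem_filter, mem_below] at hτ ⊢
        rw [← transpose_le, ← covers_transpose]; simpa using hτ
      · intro τ hτ
        rw [Finset.mem_filter, mem_below] at hτ
        rw [ih τ hτ.1]
        have := hτ.2.2; omega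
    rw [e, ← h] at h'
    have hne : ((ρ.card : ℚ) - μ.card) ≠ 0 := by
      rw [hc]; push_cast
      have : (0:ℚ) < d + 1 := by positivity
      have e : ((μ.card : ℚ) + (d + 1) - μ.card) = d + 1 := by ring
      rw [e]; exact this.ne'
    exact mul_left_cancel₀ hne h'

end FactorialLR

namespace FactorialLR

open Classical in
/-- transfer operator along a word -/
noncomputable def Ew {n : ℕ} : List (Fin n × ℤ) → (YoungDiagram → ℤ) → YoungDiagram → ℤ
  | [], h, μ => h μ
  | tb :: w, h, μ => ((kx n μ tb.1 : ℤ) - tb.2) * Ew w h μ +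
      if Addable μ tb.1 then Ew w h (addRow μ tb.1) else 0

theorem Ew_append {n : ℕ} (w w' : List (Fin n × ℤ)) (h : YoungDiagram → ℤ) (μ : YoungDiagram) :
    Ew (w ++ w') h μ = Ew w (Ew w' h) μ := by
  induction w generalizing μ with
  | nil => rfl
  | cons tb w ih => simp only [List.cons_append, Ew, ih]

theorem Ew_sum {n : ℕ} (w : List (Fin n × ℤ)) {ι : Type*} (s : Finset ι)
    (h : ι → YoungDiagram → ℤ) (μ : YoungDiagram) :
    Ew w (fun μ' => ∑ i ∈ s, h i μ') μ = ∑ i ∈ s, Ew w (h i) μ := by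
  induction w generalizing μ with
  | nil => rfl
  | cons tb w ih =>
    simp only [Ew, ih, Finset.mul_sum, Finset.sum_add_distrib]
    congr 1
    split_ifs <;> simp

theorem Ew_smul {n : ℕ} (w : List (Fin n × ℤ)) (a : ℤ)
    (h : YoungDiagram → ℤ) (μ : YoungDiagram) :
    Ew w (fun μ' => a * h μ') μ = a * Ew w h μ := by
  induction w generalizing μ with
  | nil => rfl
  | cons tb w ih =>
    simp only [Ew, ih, mul_add]
    split_ifs <;> ring

/-- `Ew w h μ` only depends on `h` at diagrams with at most `n` rows. -/
theorem Ew_congr {n : ℕ} (w : List (Fin n × ℤ)) {h h' : YoungDiagram → ℤ} {μ : YoungDiagram}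
    (hμ : μ.colLen 0 ≤ n) (hh : ∀ ν : YoungDiagram, ν.colLen 0 ≤ n → h ν = h' ν) :
    Ew w h μ = Ew w h' μ := by
  induction w generalizing μ with
  | nil => exact hh μ hμ
  | cons tb w ih =>
    simp only [Ew]
    rw [ih hμ]
    split_ifs with ha
    · rw [ih (addRow_rows ha tb.1.2 hμ)]
    · rfl

open Classical in
noncomputable def dl (ν : YoungDiagram) : YoungDiagram → ℤ := fun μ => if μ = ν then 1 else 0

theorem Ew_expand {n : ℕ} (w : List (Fin n × ℤ)) {h : YoungDiagram → ℤ} {μ : YoungDiagram}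
    (hμ : μ.colLen 0 ≤ n) (S : Finset YoungDiagram)
    (hS : ∀ ν : YoungDiagram, ν.colLen 0 ≤ n → ν ∉ S → h ν = 0) :
    Ew w h μ = ∑ ν ∈ S, h ν * Ew w (dl ν) μ := by
  classical
  rw [Ew_congr w (h' := fun μ' => ∑ ν ∈ S, h ν * dl ν μ') hμ, Ew_sum]
  · simp only [Ew_smul]
  · intro ν hν
    by_cases hm : ν ∈ S
    · simp [dl, hm]
    · simp [dl, hm, hS ν hν hm]

theorem Ew_card {n : ℕ} (w : List (Fin n × ℤ)) {μ ν : YoungDiagram}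
    (hc : μ.card + w.length < ν.card) : Ew w (dl ν) μ = 0 := by
  induction w generalizing μ with
  | nil =>
    simp only [Ew, dl]; rw [if_neg]; rintro rfl; simp at hc
  | cons tb w ih =>
    simp only [List.length_cons] at hc
    simp only [Ew]
    rw [ih (by omega)]
    split_ifs with ha
    · rw [ih (by rw [card_addRow ha]; omega)]; simp
    · simp

/-- product along a word -/
def wprod {n : ℕ} (w : List (Fin n × ℤ)) : (Fin n → ℤ) → ℤ :=
  fun x => (w.map fun tb => x tb.1 - tb.2).prod

theorem wprod_mem {n : ℕ} (w : List (Fin n × ℤ)) {i i' : Fin n}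
    (h : ∀ tb ∈ w, tb.1 ≠ i ∧ tb.1 ≠ i') : wprod w ∈ symS i i' := by
  induction w with
  | nil => exact (symS i i').one_mem
  | cons tb w ih =>
    have h1 := single_mem (h tb (by simp)).1 (h tb (by simp)).2 tb.2
    have h2 := ih (fun tb' hh => h tb' (by simp [hh]))
    have := (symS i i').mul_mem h1 h2
    convert this using 1
    funext x; simp [wprod]

theorem Ew_asym {n : ℕ} (w : List (Fin n × ℤ)) (G : (Fin n → ℤ) → ℤ)
    (hw : w.Pairwise fun a b => a.1 < b.1)
    (hG : ∀ tb ∈ w, ∀ i : Fin n, (tb.1 : ℕ) = i + 1 → G ∈ symS i tb.1) (μ : YoungDiagram)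
    (x : Fin n → ℤ) :
    Ew w (fun ν => asym (G * Bf (kx n ν)) x) μ = asym (wprod w * G * Bf (kx n μ)) x := by
  induction w generalizing μ with
  | nil =>
    have : (wprod [] : (Fin n → ℤ) → ℤ) = 1 := by funext x; simp [wprod]
    rw [this, one_mul]; rfl
  | cons tb w ih =>
    rw [List.pairwise_cons] at hw
    have ih' := ih hw.2 (fun tb' h => hG tb' (by simp [h]))
    simp only [Ew, ih']
    have e : wprod (tb :: w) * G * Bf (kx n μ) =
        (fun x => ((kx n μ tb.1 : ℤ) - tb.2) * (wprod w * G * Bf (kx n μ)) x) +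
        wprod w * G * Bf (Function.update (kx n μ) tb.1 (kx n μ tb.1 + 1)) := by
      funext x
      have := Bf_step (kx n μ) tb.1 x
      simp only [Pi.mul_apply, Pi.add_apply, wprod, List.map_cons, List.prod_cons]
      linear_combination (List.map (fun tb : Fin n × ℤ => x tb.1 - tb.2) w).prod * G x * this
    rw [e, asym_add, asym_smul, Pi.add_apply]
    congr 1
    split_ifs with ha
    · rw [kx_addRow ha]
    · obtain ⟨i, hi, hs⟩ := not_addable ha
      rw [asym_zero (i := i) (i' := tb.1) (by intro e; rw [← e] at hi; omega)]; rfl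
      apply Subring.mul_mem _ (Subring.mul_mem _ _ _) hs
      · apply wprod_mem
        intro tb' h'
        have := hw.1 tb' h'
        constructor
        · intro e; rw [e] at this; have : (tb.1 : ℕ) < i := this; omega
        · exact this.ne'
      · exact hG tb (by simp) i hi

def colword {n m : ℕ} (j : ℕ) (v : Fin m → Fin n) : List (Fin n × ℤ) :=
  List.ofFn fun r => (v r, bsh j v r)

theorem wprod_colword {n m : ℕ} (j : ℕ) (v : Fin m → Fin n) : wprod (colword j v) = wcol j v := by
  funext x
  simp only [wprod, colword, wcol, List.map_ofFn, List.prod_ofFn]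
  rfl

/-- generic iterated column sums -/
noncomputable def Yf {n : ℕ} {X : Type} (ℓ : ℕ → ℕ)
    (K : (j : ℕ) → (Fin (ℓ j) → Fin n) → (X → ℤ) → (X → ℤ)) (h : X → ℤ) :
    (j : ℕ) → {m : ℕ} → (Fin m → Fin n) → X → ℤ
  | 0, _, _ => h
  | j + 1, _, u => fun x => ∑ v ∈ colSet (ℓ j) u, K j v (Yf ℓ K h j v) x

theorem Gf_eq {n : ℕ} (ℓ : ℕ → ℕ) (j : ℕ) {m : ℕ} (u : Fin m → Fin n) :
    Gf ℓ j u = Yf ℓ (fun j v h => wcol j v * h) 1 j u := by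
  induction j generalizing m with
  | zero => rfl
  | succ j ih =>
    funext x
    simp only [Gf, Yf, Finset.sum_apply, ih]

theorem Mj {n : ℕ} {ℓ : ℕ → ℕ} (hℓ : Antitone ℓ) (j : ℕ) {m : ℕ} (u : Fin m → Fin n)
    (μ : YoungDiagram) (x : Fin n → ℤ) :
    Yf ℓ (fun j v => Ew (colword j v)) (fun ν => Af n ν x) j u μ =
      asym (Gf ℓ j u * Bf (kx n μ)) x := by
  induction j generalizing m μ with
  | zero => simp only [Yf, Gf, one_mul]; rfl
  | succ j ih =>
    simp only [Yf, Gf, Finset.sum_mul, asym_sum, Finset.sum_apply]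
    apply Finset.sum_congr rfl
    intro v hv
    rw [mem_colSet] at hv
    have : Yf ℓ (fun j v => Ew (colword j v)) (fun ν => Af n ν x) j v =
      fun μ => asym (Gf ℓ j v * Bf (kx n μ)) x := by funext μ; exact ih v μ
    rw [this, Ew_asym, wprod_colword]
    · unfold colword
      rw [List.pairwise_ofFn]
      intro a b hab; exact hv.1 hab
    · intro tb htb i hi
      unfold colword at htb
      rw [List.mem_ofFn'] at htb
      obtain ⟨r, rfl⟩ := htb
      exact (SP hℓ hi j).1 v (fun c hc => hℓ hc.le) hv.1 (fun _ => ⟨r, rfl⟩)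

noncomputable def sL (n : ℕ) (lam : YoungDiagram) : (Fin n → ℤ) → ℤ :=
  Gf (fun j => lam.colLen j) (lam.rowLen 0) (Fin.elim0 : Fin 0 → Fin n)

theorem sL_symm {n : ℕ} (lam : YoungDiagram) (σ : Equiv.Perm (Fin n)) (x : Fin n → ℤ) :
    sL n lam (x ∘ σ) = sL n lam x := by
  cases n with
  | zero => congr 1; funext i; exact i.elim0
  | succ m =>
  have hσ : σ ∈ Submonoid.closure (Set.range fun i : Fin m => Equiv.swap i.castSucc i.succ) := by
    rw [Equiv.Perm.mclosure_swap_castSucc_succ]; trivial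
  induction hσ using Submonoid.closure_induction generalizing x with
  | mem y hy =>
    obtain ⟨i, rfl⟩ := hy
    have hA : Antitone (fun j => lam.colLen j) := fun a b h => lam.colLen_anti _ _ h
    have := (SP (n := m+1) hA (i := i.castSucc) (i' := i.succ) (by simp) (lam.rowLen 0)).1
      (Fin.elim0 : Fin 0 → Fin (m+1)) (fun c _ => Nat.zero_le _) (fun a => a.elim0) 
      (fun ⟨r, _⟩ => r.elim0)
    exact this x
  | one => rfl
  | mul a b _ _ ha hb =>
    have : x ∘ ⇑(a * b) = (x ∘ a) ∘ b := rfl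
    rw [this, hb, ha]

theorem Mmain {n : ℕ} (lam μ : YoungDiagram) (x : Fin n → ℤ) :
    Yf (fun j => lam.colLen j) (fun j v => Ew (colword j v)) (fun ν => Af n ν x) (lam.rowLen 0)
      (Fin.elim0 : Fin 0 → Fin n) μ = sL n lam x * Af n μ x := by
  rw [Mj (fun a b h => lam.colLen_anti _ _ h), ]
  change asym (sL n lam * _) x = _
  rw [asym_mul_sym (sL_symm lam)]; rfl

end FactorialLR

namespace FactorialLR

section colfam
variable {n : ℕ} (ℓ : ℕ → ℕ)

abbrev Fam (n : ℕ) (ℓ : ℕ → ℕ) (j : ℕ) : Type := (c : Fin j) → Fin (ℓ c) → Fin n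

def finit {j : ℕ} (T : Fam n ℓ (j + 1)) : Fam n ℓ j := fun c => T c.castSucc
def flast {j : ℕ} (T : Fam n ℓ (j + 1)) : Fin (ℓ j) → Fin n := T (Fin.last j)

def Adm : (j : ℕ) → Fam n ℓ j → {m : ℕ} → (Fin m → Fin n) → Prop
  | 0, _, _, _ => True
  | j + 1, T, _, u => (StrictMono (flast ℓ T) ∧ Compat (flast ℓ T) u) ∧
      Adm j (finit ℓ T) (flast ℓ T)

def compK {X : Type} (K : (j : ℕ) → (Fin (ℓ j) → Fin n) → (X → ℤ) → (X → ℤ)) (h : X → ℤ) :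
    (j : ℕ) → Fam n ℓ j → X → ℤ
  | 0, _ => h
  | j + 1, T => K j (flast ℓ T) (compK K h j (finit ℓ T))

def fequiv (j : ℕ) : ((Fin (ℓ j) → Fin n) × Fam n ℓ j) ≃ Fam n ℓ (j + 1) :=
  Fin.snocEquiv (fun c : Fin (j + 1) => Fin (ℓ c) → Fin n)

theorem flast_fequiv (j : ℕ) (p : (Fin (ℓ j) → Fin n) × Fam n ℓ j) :
    flast ℓ (fequiv ℓ j p) = p.1 := by
  simp only [flast, fequiv, Fin.snocEquiv]
  exact Fin.snoc_last (α := fun c : Fin (j + 1) => Fin (ℓ c) → Fin n) _ _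

theorem finit_fequiv (j : ℕ) (p : (Fin (ℓ j) → Fin n) × Fam n ℓ j) :
    finit ℓ (fequiv ℓ j p) = p.2 := by
  funext c
  simp only [finit, fequiv, Fin.snocEquiv]
  exact Fin.snoc_castSucc (α := fun c : Fin (j + 1) => Fin (ℓ c) → Fin n) _ _ _

open Classical in
theorem Yf_eq {X : Type} (K : (j : ℕ) → (Fin (ℓ j) → Fin n) → (X → ℤ) → (X → ℤ))
    (hK : ∀ j v {ι : Type} (s : Finset ι) (h : ι → X → ℤ) x,
      K j v (fun x => ∑ i ∈ s, h i x) x = ∑ i ∈ s, K j v (h i) x)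
    (h : X → ℤ) (j : ℕ) {m : ℕ} (u : Fin m → Fin n) :
    Yf ℓ K h j u = fun x => ∑ T ∈ Finset.univ.filter (fun T : Fam n ℓ j => Adm ℓ j T u),
      compK ℓ K h j T x := by
  induction j generalizing m with
  | zero =>
    funext x
    have : (Finset.univ.filter (fun T : Fam n ℓ 0 => Adm ℓ 0 T u)) = {fun c => c.elim0} := by
      ext T
      rw [Finset.mem_filter, Finset.mem_singleton]
      exact ⟨fun _ => funext fun c => c.elim0, fun _ => ⟨Finset.mem_univ _, trivial⟩⟩
    rw [this, Finset.sum_singleton]; rfl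
  | succ j ih =>
    funext x
    simp only [Yf]
    rw [Finset.sum_filter, ← Equiv.sum_comp (fequiv ℓ j), Fintype.sum_prod_type]
    unfold colSet
    rw [Finset.sum_filter]
    apply Finset.sum_congr rfl
    intro v _
    split_ifs with hv
    · rw [ih, hK, Finset.sum_filter]
      apply Finset.sum_congr rfl
      intro T _
      simp only [Adm, flast_fequiv, finit_fequiv, compK, hv, and_self, true_and]
    · symm; apply Finset.sum_eq_zero
      intro T _
      rw [if_neg]
      simp only [Adm, flast_fequiv]
      exact fun h => hv h.1

/-- columns of a total filling -/
def famOf (τ : ℕ × ℕ → Fin n) (j : ℕ) : Fam n ℓ j := fun c r => τ (r, c)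

def colOf (τ : ℕ × ℕ → Fin n) (j : ℕ) : Fin (ℓ j) → Fin n := fun r => τ (r, j)

def cellList : ℕ → List (ℕ × ℕ)
  | 0 => []
  | j + 1 => (List.ofFn fun r : Fin (ℓ j) => ((r : ℕ), j)) ++ cellList j

def ent (τ : ℕ × ℕ → Fin n) (c : ℕ × ℕ) : Fin n × ℤ := (τ c, (τ c : ℤ) + c.2 - c.1)

theorem comp_E (τ : ℕ × ℕ → Fin n) (h : YoungDiagram → ℤ) (j : ℕ) :
    compK ℓ (fun j v => Ew (colword j v)) h j (famOf ℓ τ j) =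
      Ew ((cellList ℓ j).map (ent τ)) h := by
  induction j with
  | zero => rfl
  | succ j ih =>
    funext μ
    simp only [cellList, List.map_append, Ew_append, List.map_ofFn, compK]
    rw [← ih]; rfl

theorem comp_P (τ : ℕ × ℕ → Fin n) (j : ℕ) :
    compK ℓ (fun j v h => wcol j v * h) 1 j (famOf ℓ τ j) =
      wprod ((cellList ℓ j).map (ent τ)) := by
  induction j with
  | zero => funext x; simp [compK, cellList, wprod]
  | succ j ih =>
    have e : compK ℓ (fun j v h => wcol j v * h) 1 (j + 1) (famOf ℓ τ (j + 1)) =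
      wcol j (colOf ℓ τ j) * compK ℓ (fun j v h => wcol j v * h) 1 j (famOf ℓ τ j) := rfl
    rw [e, ih, ← wprod_colword]
    funext μ
    simp only [cellList, List.map_append, wprod, List.map_ofFn, Pi.mul_apply, List.prod_append,
      colword]
    rfl

theorem adm_famOf (τ : ℕ × ℕ → Fin n) (j : ℕ) {m : ℕ} (u : Fin m → Fin n) :
    Adm ℓ j (famOf ℓ τ j) u ↔ (∀ c < j, StrictMono (colOf ℓ τ c)) ∧
      (∀ c, c + 1 < j → Compat (colOf ℓ τ c) (colOf ℓ τ (c + 1))) ∧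
      (∀ c, c + 1 = j → Compat (colOf ℓ τ c) u) := by
  induction j generalizing m with
  | zero => simp [Adm]
  | succ j ih =>
    have e : Adm ℓ (j + 1) (famOf ℓ τ (j + 1)) u ↔ (StrictMono (colOf ℓ τ j) ∧
      Compat (colOf ℓ τ j) u) ∧ Adm ℓ j (famOf ℓ τ j) (colOf ℓ τ j) := Iff.rfl
    rw [e, ih]
    constructor
    · rintro ⟨⟨h1, h2⟩, h3, h4, h5⟩
      refine ⟨fun c hc => ?_, fun c hc => ?_, fun c hc => ?_⟩
      · rcases Nat.lt_succ_iff_lt_or_eq.1 hc with h | rfl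
        · exact h3 c h
        · exact h1
      · rcases Nat.lt_succ_iff_lt_or_eq.1 hc with h | rfl
        · exact h4 c h
        · exact h5 c rfl
      · obtain rfl : c = j := by omega
        exact h2
    · rintro ⟨h1, h2, h3⟩
      refine ⟨⟨h1 j (by omega), h3 j rfl⟩, fun c hc => h1 c (by omega), fun c hc => h2 c (by omega), ?_⟩
      rintro c rfl; exact h2 c (by omega)

end colfam

section fill
variable {n : ℕ} [NeZero n] (lam : YoungDiagram)

/-- total extension of a filling -/
def tot {s : Finset (ℕ × ℕ)} (T : s → Fin n) : ℕ × ℕ → Fin n :=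
  fun c => if h : c ∈ s then T ⟨c, h⟩ else 0

theorem tot_coe {s : Finset (ℕ × ℕ)} (T : s → Fin n) (c : s) : tot T c = T c := by
  simp [tot]

theorem tot_mem {s : Finset (ℕ × ℕ)} (T : s → Fin n) {c} (h : c ∈ s) : tot T c = T ⟨c, h⟩ := by
  simp [tot, h]

theorem ssyt_iff (T : lam.cells → Fin n) :
    Adm (fun j => lam.colLen j) (lam.rowLen 0) (famOf (fun j => lam.colLen j) (tot T) (lam.rowLen 0))
      (Fin.elim0 : Fin 0 → Fin n) ↔ IsSsyt lam.cells T := by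
  rw [adm_famOf]
  constructor
  · rintro ⟨h1, h2, -⟩
    constructor
    · have key : ∀ i j j', j ≤ j' → (i, j') ∈ lam → tot T (i, j) ≤ tot T (i, j') := by
        intro i j j' hj
        induction j', hj using Nat.le_induction with
        | base => intro _; exact le_rfl
        | succ k hk ih =>
          intro hm
          have hm' : (i, k) ∈ lam := lam.up_left_mem le_rfl (Nat.le_succ k) hm
          refine (ih hm').trans ?_
          have hlt : k + 1 < lam.rowLen 0 :=
            YoungDiagram.mem_iff_lt_rowLen.1 (lam.up_left_mem (Nat.zero_le i) le_rfl hm)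
          exact h2 k hlt i (YoungDiagram.mem_iff_lt_colLen.1 hm) (YoungDiagram.mem_iff_lt_colLen.1 hm')
      rintro ⟨⟨i, j⟩, hc⟩ ⟨⟨i', j'⟩, hc'⟩ h h'
      simp only at h h'
      subst h
      have := key i j j' h' hc'
      rwa [tot_mem T hc, tot_mem T hc'] at this
    · rintro ⟨⟨i, j⟩, hc⟩ ⟨⟨i', j'⟩, hc'⟩ h h'
      simp only at h h'
      subst h'
      have hlt : j < lam.rowLen 0 :=
            YoungDiagram.mem_iff_lt_rowLen.1 (lam.up_left_mem (Nat.zero_le i) le_rfl hc)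
      have := h1 j hlt (a := ⟨i, YoungDiagram.mem_iff_lt_colLen.1 hc⟩)
        (b := ⟨i', YoungDiagram.mem_iff_lt_colLen.1 hc'⟩) h
      simp only [colOf] at this
      rwa [tot_mem T hc, tot_mem T hc'] at this
  · rintro ⟨h1, h2⟩
    refine ⟨?_, ?_, ?_⟩
    · intro c hc a b hab
      have ha : ((a : ℕ), c) ∈ lam.cells := YoungDiagram.mem_iff_lt_colLen.2 a.2
      have hb : ((b : ℕ), c) ∈ lam.cells := YoungDiagram.mem_iff_lt_colLen.2 b.2
      simp only [colOf]
      rw [tot_mem T ha, tot_mem T hb]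
      exact h2 _ _ hab rfl
    · intro c hc r h h'
      have ha : (r, c) ∈ lam.cells := YoungDiagram.mem_iff_lt_colLen.2 h'
      have hb : (r, c + 1) ∈ lam.cells := YoungDiagram.mem_iff_lt_colLen.2 h
      simp only [colOf]
      rw [tot_mem T ha, tot_mem T hb]
      exact h1 _ _ rfl (Nat.le_succ c)
    · intro c _ r h; exact absurd h (Nat.not_lt_zero _)

open Classical in
/-- semistandard fillings -/
noncomputable def SS (n : ℕ) (lam : YoungDiagram) : Finset (lam.cells → Fin n) :=
  Finset.univ.filter fun T => IsSsyt lam.cells T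

/-- the cells in column order -/
def cl : List (ℕ × ℕ) := cellList (fun j => lam.colLen j) (lam.rowLen 0)

theorem Yf_fill {X : Type}
    (K : (j : ℕ) → (Fin (lam.colLen j) → Fin n) → (X → ℤ) → (X → ℤ))
    (hK : ∀ j v {ι : Type} (s : Finset ι) (h : ι → X → ℤ) x,
      K j v (fun x => ∑ i ∈ s, h i x) x = ∑ i ∈ s, K j v (h i) x) (h : X → ℤ) (x : X) :
    Yf (fun j => lam.colLen j) K h (lam.rowLen 0) (Fin.elim0 : Fin 0 → Fin n) x =
      ∑ T ∈ SS n lam, compK _ K h _ (famOf (fun j => lam.colLen j) (tot T) (lam.rowLen 0)) x := by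
  classical
  rw [Yf_eq _ K hK]
  symm
  have hfam : ∀ F : Fam n (fun j => lam.colLen j) (lam.rowLen 0), 
      famOf (fun j => lam.colLen j) (tot (fun c : lam.cells => F ⟨c.1.2, 
        YoungDiagram.mem_iff_lt_rowLen.1 (lam.up_left_mem (Nat.zero_le c.1.1) le_rfl c.2)⟩ 
        ⟨c.1.1, YoungDiagram.mem_iff_lt_colLen.1 c.2⟩)) (lam.rowLen 0) = F := by
    intro F
    funext c r
    simp only [famOf]
    have ha : ((r : ℕ), (c : ℕ)) ∈ lam.cells := YoungDiagram.mem_iff_lt_colLen.2 r.2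
    rw [tot_mem _ ha]
  refine Finset.sum_bij' (fun T _ => famOf (fun j => lam.colLen j) (tot T) (lam.rowLen 0))
    (fun F _ => fun c => F ⟨c.1.2, 
        YoungDiagram.mem_iff_lt_rowLen.1 (lam.up_left_mem (Nat.zero_le c.1.1) le_rfl c.2)⟩ 
        ⟨c.1.1, YoungDiagram.mem_iff_lt_colLen.1 c.2⟩) ?_ ?_ ?_ ?_ ?_
  · intro T hT
    simp only [SS, Finset.mem_filter, Finset.mem_univ, true_and] at hT ⊢
    exact (ssyt_iff lam T).2 hT
  · intro F hF
    simp only [SS, Finset.mem_filter, Finset.mem_univ, true_and] at hF ⊢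
    rw [← ssyt_iff, hfam]; exact hF
  · intro T _; funext c; simp only [famOf]; exact tot_coe T c
  · intro F _; exact hfam F
  · intro T _; rfl

theorem YfE_fill (h : YoungDiagram → ℤ) (μ : YoungDiagram) :
    Yf (fun j => lam.colLen j) (fun j v => Ew (colword j v)) h (lam.rowLen 0)
      (Fin.elim0 : Fin 0 → Fin n) μ = ∑ T ∈ SS n lam, Ew ((cl lam).map (ent (tot T))) h μ := by
  rw [Yf_fill lam _ (fun j v ι s h x => Ew_sum _ s h x)]
  simp only [comp_E]; rfl

theorem sL_fill (x : Fin n → ℤ) :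
    sL n lam x = ∑ T ∈ SS n lam, wprod ((cl lam).map (ent (tot T))) x := by
  unfold sL
  rw [Gf_eq, Yf_fill]
  · simp only [comp_P]; rfl
  · intro j v ι s h x
    simp only [Pi.mul_apply, Finset.mul_sum]

theorem mem_cellList (ℓ : ℕ → ℕ) (j : ℕ) (c : ℕ × ℕ) :
    c ∈ cellList ℓ j ↔ c.2 < j ∧ c.1 < ℓ c.2 := by
  induction j with
  | zero => simp [cellList]
  | succ j ih =>
    simp only [cellList, List.mem_append, ih, List.mem_ofFn', Set.mem_range]
    constructor
    · rintro (⟨r, rfl⟩ | h)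
      · exact ⟨Nat.lt_succ_self j, r.2⟩
      · exact ⟨by omega, h.2⟩
    · rintro ⟨h1, h2⟩
      by_cases h : c.2 = j
      · left; exact ⟨⟨c.1, h ▸ h2⟩, by ext <;> simp [h]⟩
      · right; exact ⟨by omega, h2⟩

theorem pairwise_cellList (ℓ : ℕ → ℕ) (j : ℕ) : (cellList ℓ j).Pairwise ColLT := by
  induction j with
  | zero => simp [cellList]
  | succ j ih =>
    simp only [cellList, List.pairwise_append, ih, true_and, List.pairwise_ofFn]
    refine ⟨fun a b hab => Or.inr ⟨rfl, hab⟩, ?_⟩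
    intro a ha b hb
    rw [mem_cellList] at hb
    rw [List.mem_ofFn'] at ha
    obtain ⟨r, rfl⟩ := ha
    exact Or.inl hb.1

theorem mem_cl (c : ℕ × ℕ) : c ∈ cl lam ↔ c ∈ lam.cells := by
  rw [cl, mem_cellList, ← YoungDiagram.mem_iff_lt_colLen]
  constructor
  · exact fun h => h.2
  · intro h
    exact ⟨YoungDiagram.mem_iff_lt_rowLen.1 (lam.up_left_mem (Nat.zero_le c.1) le_rfl h), h⟩

theorem cl_toFinset : (cl lam).toFinset = lam.cells := by
  ext c; rw [List.mem_toFinset, mem_cl]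

theorem ColLT_asymm {a b : ℕ × ℕ} (h : ColLT a b) : ¬ ColLT b a := by
  unfold ColLT at *; omega

theorem ColLT_irrefl (a : ℕ × ℕ) : ¬ ColLT a a := by
  unfold ColLT at *; omega

theorem nodup_of_pairwise {l : List (ℕ × ℕ)} (h : l.Pairwise ColLT) : l.Nodup :=
  h.imp (fun {a b} hab => by rintro rfl; exact ColLT_irrefl a hab)

theorem cl_pairwise : (cl lam).Pairwise ColLT := pairwise_cellList _ _

theorem cl_length : (cl lam).length = lam.card := by
  rw [← List.toFinset_card_of_nodup (nodup_of_pairwise (cl_pairwise lam)), cl_toFinset]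

theorem wprod_cl (τ : ℕ × ℕ → Fin n) (x : Fin n → ℤ) :
    wprod ((cl lam).map (ent τ)) x = ∏ c ∈ lam.cells, (x (τ c) - ((τ c : ℤ) + c.2 - c.1)) := by
  rw [← cl_toFinset, List.prod_toFinset _ (nodup_of_pairwise (cl_pairwise lam))]
  simp only [wprod, List.map_map]; rfl

end fill
end FactorialLR

namespace FactorialLR

section bars
variable {n : ℕ}

/-- weight of an unbarred cell -/
def wt (τ : ℕ × ℕ → Fin n) (κ : YoungDiagram) (c : ℕ × ℕ) : ℤ :=
  (κ.rowLen (τ c) : ℤ) + (n : ℤ) - 2 * ((τ c : ℤ) + 1) - ((c.2 : ℤ) - (c.1 : ℤ)) + 1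

theorem wt_eq (τ : ℕ × ℕ → Fin n) (κ : YoungDiagram) (c : ℕ × ℕ) :
    wt τ κ c = (kx n κ (ent τ c).1 : ℤ) - (ent τ c).2 := by
  have := (τ c).2
  simp only [wt, kx, ent]
  push_cast [Nat.sub_sub, Nat.cast_sub (show 1 + (τ c : ℕ) ≤ n by omega)]
  ring

def Good (τ : ℕ × ℕ → Fin n) (Lf : ℕ → YoungDiagram) {m : ℕ} (β : Fin m → ℕ × ℕ) : Prop :=
  (∀ i j : Fin m, i < j → ColLT (β i) (β j)) ∧
    ∀ i : Fin m, (τ (β i) : ℕ) = stepRow (Lf i) (Lf ((i : ℕ) + 1))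

open Classical in
noncomputable def tm (τ : ℕ × ℕ → Fin n) (Lf : ℕ → YoungDiagram) {m : ℕ} (β : Fin m → ℕ × ℕ)
    (c : ℕ × ℕ) : ℤ :=
  if ∃ i, β i = c then 1 else
    wt τ (Lf (Finset.univ.filter fun i : Fin m => ColLT (β i) c).card) c

open Classical in
noncomputable def Nb (τ : ℕ × ℕ → Fin n) (s : Finset (ℕ × ℕ)) (Lf : ℕ → YoungDiagram) (m : ℕ) : ℤ :=
  ∑ β ∈ (Fintype.piFinset fun _ : Fin m => s).filter (Good τ Lf), ∏ c ∈ s, tm τ Lf β c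

theorem Nb_empty_zero (τ : ℕ × ℕ → Fin n) (Lf : ℕ → YoungDiagram) : Nb τ ∅ Lf 0 = 1 := by
  classical
  unfold Nb
  have : ((Fintype.piFinset fun _ : Fin 0 => (∅ : Finset (ℕ × ℕ))).filter (Good τ Lf)) =
      {fun i => i.elim0} := by
    ext β
    rw [Finset.mem_filter, Finset.mem_singleton]
    refine ⟨fun _ => funext fun c => c.elim0, fun _ => ⟨?_, ?_, ?_⟩⟩
    · rw [Fintype.mem_piFinset]; exact fun i => i.elim0
    · exact fun i => i.elim0
    · exact fun i => i.elim0
  rw [this]; simp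

theorem Nb_empty_succ (τ : ℕ × ℕ → Fin n) (Lf : ℕ → YoungDiagram) (m : ℕ) :
    Nb τ ∅ Lf (m + 1) = 0 := by
  classical
  unfold Nb
  apply Finset.sum_eq_zero
  intro β hβ
  rw [Finset.mem_filter, Fintype.mem_piFinset] at hβ
  exact absurd (hβ.1 0) (Finset.notMem_empty _)

open Classical in
theorem Nb_un (τ : ℕ × ℕ → Fin n) {s : Finset (ℕ × ℕ)} {c0 : ℕ × ℕ} (h0 : ∀ c ∈ s, ColLT c0 c)
    (Lf : ℕ → YoungDiagram) (m : ℕ) :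
    ∑ β ∈ ((Fintype.piFinset fun _ : Fin m => insert c0 s).filter (Good τ Lf)).filter
      (fun β => ¬ ∃ i, β i = c0), ∏ c ∈ insert c0 s, tm τ Lf β c = wt τ (Lf 0) c0 * Nb τ s Lf m := by
  have hc0 : c0 ∉ s := fun h => ColLT_irrefl _ (h0 _ h)
  unfold Nb
  rw [Finset.mul_sum]
  apply Finset.sum_congr
  · ext β
    simp only [Finset.mem_filter, Fintype.mem_piFinset, Finset.mem_insert]
    constructor
    · rintro ⟨⟨h1, h2⟩, h3⟩
      exact ⟨fun i => (h1 i).resolve_left fun e => h3 ⟨i, e⟩, h2⟩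
    · rintro ⟨h1, h2⟩
      exact ⟨⟨fun i => Or.inr (h1 i), h2⟩, fun ⟨i, e⟩ => hc0 (e ▸ h1 i)⟩
  · intro β hβ
    simp only [Finset.mem_filter, Fintype.mem_piFinset] at hβ
    rw [Finset.prod_insert hc0]
    congr 1
    unfold tm
    rw [if_neg (fun ⟨i, e⟩ => hc0 (e ▸ hβ.1 i))]
    rw [Finset.filter_false_of_mem, Finset.card_empty]
    intro i _
    exact ColLT_asymm (h0 _ (hβ.1 i))

open Classical in
theorem Nb_bar (τ : ℕ × ℕ → Fin n) {s : Finset (ℕ × ℕ)} {c0 : ℕ × ℕ} (h0 : ∀ c ∈ s, ColLT c0 c)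
    (Lf : ℕ → YoungDiagram) (m : ℕ) :
    ∑ β ∈ ((Fintype.piFinset fun _ : Fin (m + 1) => insert c0 s).filter (Good τ Lf)).filter
      (fun β => ∃ i, β i = c0), ∏ c ∈ insert c0 s, tm τ Lf β c =
    if (τ c0 : ℕ) = stepRow (Lf 0) (Lf 1) then Nb τ s (fun i => Lf (i + 1)) m else 0 := by
  have hc0 : c0 ∉ s := fun h => ColLT_irrefl _ (h0 _ h)
  have hz : ∀ β : Fin (m + 1) → ℕ × ℕ, (∀ i, β i = c0 ∨ β i ∈ s) → Good τ Lf β →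
      (∃ i, β i = c0) → β 0 = c0 := by
    rintro β h1 h2 ⟨i, hi⟩
    by_contra hne
    have hi0 : (0 : Fin (m + 1)) < i := by
      rw [Fin.pos_iff_ne_zero]; rintro rfl; exact hne hi
    have := h2.1 _ _ hi0
    rw [hi] at this
    exact ColLT_asymm this (h0 _ ((h1 0).resolve_left hne))
  split_ifs with hr
  · unfold Nb
    refine Finset.sum_bij' (fun β _ => Fin.tail β) (fun γ _ => Fin.cons c0 γ) ?_ ?_ ?_ ?_ ?_
    · intro β hβ
      simp only [Finset.mem_filter, Fintype.mem_piFinset, Finset.mem_insert] at hβ ⊢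
      obtain ⟨⟨h1, h2⟩, h3⟩ := hβ
      have hb0 := hz β h1 h2 h3
      refine ⟨fun i => ?_, fun i j hij => ?_, fun i => ?_⟩
      · refine (h1 i.succ).resolve_left fun e => ?_
        have := h2.1 0 i.succ (Fin.succ_pos i)
        rw [hb0, e] at this
        exact ColLT_irrefl _ this
      · exact h2.1 _ _ (Fin.succ_lt_succ_iff.2 hij)
      · exact h2.2 i.succ
    · intro γ hγ
      simp only [Finset.mem_filter, Fintype.mem_piFinset, Finset.mem_insert] at hγ ⊢
      obtain ⟨h1, h2⟩ := hγ
      refine ⟨⟨fun i => ?_, fun i j hij => ?_, fun i => ?_⟩, 0, rfl⟩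
      · refine Fin.cases ?_ (fun i => ?_) i
        · left; rfl
        · right; exact h1 i
      · revert hij
        refine Fin.cases ?_ (fun j => ?_) j
        · intro hij; exact absurd hij (Fin.not_lt_zero i)
        · refine Fin.cases ?_ (fun i => ?_) i
          · intro _; exact h0 _ (h1 j)
          · intro hij; exact h2.1 i j (Fin.succ_lt_succ_iff.1 hij)
      · refine Fin.cases ?_ (fun i => ?_) i
        · exact hr
        · exact h2.2 i
    · intro β hβ
      simp only [Finset.mem_filter, Fintype.mem_piFinset, Finset.mem_insert] at hβ
      obtain ⟨⟨h1, h2⟩, h3⟩ := hβ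
      have hb0 := hz β h1 h2 h3
      conv_rhs => rw [← Fin.cons_self_tail β]
      rw [hb0]
    · intro γ _; exact Fin.tail_cons _ _
    · intro β hβ
      simp only [Finset.mem_filter, Fintype.mem_piFinset, Finset.mem_insert] at hβ
      obtain ⟨⟨h1, h2⟩, h3⟩ := hβ
      have hb0 := hz β h1 h2 h3
      rw [Finset.prod_insert hc0]
      have : tm τ Lf β c0 = 1 := by unfold tm; rw [if_pos h3]
      rw [this, one_mul]
      apply Finset.prod_congr rfl
      intro c hc
      unfold tm
      have e1 : (∃ i, β i = c) ↔ ∃ i, Fin.tail β i = c := by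
        rw [Fin.exists_fin_succ]
        refine or_iff_right ?_
        rw [hb0]; rintro rfl; exact hc0 hc
      have e2 : (Finset.univ.filter fun i : Fin (m + 1) => ColLT (β i) c).card =
          (Finset.univ.filter fun i : Fin m => ColLT (Fin.tail β i) c).card + 1 := by
        rw [Fin.card_filter_univ_succ, if_pos]
        · rfl
        · rw [hb0]; exact h0 c hc
      simp only [e1]
      rw [e2]
  · apply Finset.sum_eq_zero
    intro β hβ
    simp only [Finset.mem_filter, Fintype.mem_piFinset, Finset.mem_insert] at hβ
    obtain ⟨⟨h1, h2⟩, h3⟩ := hβ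
    have hb0 := hz β h1 h2 h3
    exfalso; apply hr
    have := h2.2 0
    rw [hb0] at this
    exact this

theorem Nb_zero (τ : ℕ × ℕ → Fin n) {s : Finset (ℕ × ℕ)} {c0 : ℕ × ℕ} (h0 : ∀ c ∈ s, ColLT c0 c)
    (Lf : ℕ → YoungDiagram) : Nb τ (insert c0 s) Lf 0 = wt τ (Lf 0) c0 * Nb τ s Lf 0 := by
  classical
  rw [← Nb_un τ h0 Lf 0, Finset.filter_true_of_mem]
  · rfl
  · rintro β - ⟨i, -⟩; exact i.elim0

open Classical in
theorem Nb_succ (τ : ℕ × ℕ → Fin n) {s : Finset (ℕ × ℕ)} {c0 : ℕ × ℕ} (h0 : ∀ c ∈ s, ColLT c0 c)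
    (Lf : ℕ → YoungDiagram) (m : ℕ) : Nb τ (insert c0 s) Lf (m + 1) =
      wt τ (Lf 0) c0 * Nb τ s Lf (m + 1) +
      if (τ c0 : ℕ) = stepRow (Lf 0) (Lf 1) then Nb τ s (fun i => Lf (i + 1)) m else 0 := by
  rw [← Nb_un τ h0 Lf (m + 1), ← Nb_bar τ h0 Lf m]
  unfold Nb
  refine Eq.trans ?_ (add_comm _ _)
  exact (Finset.sum_filter_add_sum_filter_not
    ((Fintype.piFinset fun _ : Fin (m + 1) => insert c0 s).filter (Good τ Lf))
    (fun β => ∃ i, β i = c0) (fun β => ∏ c ∈ insert c0 s, tm τ Lf β c)).symm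

end bars

section chains

open Classical in
noncomputable def chF : ℕ → YoungDiagram → YoungDiagram → Finset (List YoungDiagram)
  | 0, μ, ν => if μ = ν then {[μ]} else ∅
  | d + 1, μ, ν => ((below ν).filter (Covers μ)).biUnion fun κ => (chF d κ ν).image (List.cons μ)

theorem chF_head {d : ℕ} {μ ν : YoungDiagram} {L : List YoungDiagram} (h : L ∈ chF d μ ν) :
    ∃ L', L = μ :: L' := by
  cases d with
  | zero =>
    simp only [chF] at h
    split_ifs at h with he
    · rw [Finset.mem_singleton] at h; exact ⟨[], h⟩
    · simp at h
  | succ d =>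
    simp only [chF, Finset.mem_biUnion, Finset.mem_image] at h
    obtain ⟨κ, _, L', _, rfl⟩ := h
    exact ⟨L', rfl⟩

theorem chF_le {d : ℕ} {μ ν : YoungDiagram} {L : List YoungDiagram} (h : L ∈ chF d μ ν) : μ ≤ ν := by
  cases d with
  | zero =>
    simp only [chF] at h
    split_ifs at h with he
    · exact he.le
    · simp at h
  | succ d =>
    simp only [chF, Finset.mem_biUnion, Finset.mem_filter, mem_below] at h
    obtain ⟨κ, ⟨h1, h2⟩, _⟩ := h
    exact h2.1.trans h1

theorem chF_length {d : ℕ} {μ ν : YoungDiagram} {L : List YoungDiagram} (h : L ∈ chF d μ ν) :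
    L.length = d + 1 := by
  induction d generalizing μ L with
  | zero =>
    simp only [chF] at h
    split_ifs at h with he
    · rw [Finset.mem_singleton] at h; simp [h]
    · simp at h
  | succ d ih =>
    simp only [chF, Finset.mem_biUnion, Finset.mem_image] at h
    obtain ⟨κ, _, L', h', rfl⟩ := h
    simp [ih h']

theorem chF_sum (d : ℕ) (μ ν : YoungDiagram) (F : List YoungDiagram → ℤ) :
    ∑ L ∈ chF (d + 1) μ ν, F L = open Classical in ∑ κ ∈ (below ν).filter (Covers μ),
      ∑ L ∈ chF d κ ν, F (μ :: L) := by
  classical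
  simp only [chF]
  rw [Finset.sum_biUnion]
  · apply Finset.sum_congr (by congr)
    intro κ _
    rw [Finset.sum_image]
    intro a _ b _ hab
    simpa using hab
  · intro κ _ κ' _ hne
    rw [Function.onFun, Finset.disjoint_left]
    intro L h h'
    rw [Finset.mem_image] at h h'
    obtain ⟨L1, h1, rfl⟩ := h
    obtain ⟨L2, h2, e⟩ := h'
    obtain ⟨_, rfl⟩ := chF_head h1
    obtain ⟨_, rfl⟩ := chF_head h2
    simp only [List.cons.injEq] at e
    exact hne e.2.1.symm

theorem mem_chF {d : ℕ} {μ ν : YoungDiagram} {L : List YoungDiagram} :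
    L ∈ chF d μ ν ↔ L ∈ chainSet μ ν ∧ L.length = d + 1 := by
  induction d generalizing μ L with
  | zero =>
    constructor
    · intro h
      refine ⟨?_, chF_length h⟩
      simp only [chF] at h
      split_ifs at h with he
      · rw [Finset.mem_singleton] at h; subst h; subst he; exact ⟨List.isChain_singleton _, rfl, rfl⟩
      · simp at h
    · rintro ⟨⟨_, h2, h3⟩, h4⟩
      obtain ⟨a, rfl⟩ := List.length_eq_one_iff.1 h4
      simp only [List.head?_cons, Option.some.injEq, List.getLast?_singleton] at h2 h3
      subst h2; subst h3
      simp [chF]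
  | succ d ih =>
    simp only [chF, Finset.mem_biUnion, Finset.mem_image, Finset.mem_filter, mem_below]
    constructor
    · rintro ⟨κ, ⟨h1, h2⟩, L', h', rfl⟩
      obtain ⟨L'', rfl⟩ := chF_head h'
      rw [ih] at h'
      obtain ⟨⟨h3, h4, h5⟩, h6⟩ := h'
      refine ⟨⟨?_, rfl, ?_⟩, by simpa using h6⟩
      · exact List.isChain_cons_cons.2 ⟨h2, h3⟩
      · rw [List.getLast?_cons_cons]; exact h5
    · rintro ⟨⟨h3, h4, h5⟩, h6⟩
      match L, h3, h4, h5, h6 with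
      | [], _, h4, _, _ => simp at h4
      | [_], _, _, _, h6 => simp at h6
      | a :: κ :: L', h3, h4, h5, h6 =>
        simp only [List.head?_cons, Option.some.injEq] at h4
        subst h4
        have h3' := List.isChain_cons_cons.1 h3
        have hm : (κ :: L') ∈ chF d κ ν := by
          rw [ih]
          refine ⟨⟨h3'.2, rfl, ?_⟩, by simpa using h6⟩
          rw [List.getLast?_cons_cons] at h5; exact h5
        exact ⟨κ, ⟨chF_le hm, h3'.1⟩, κ :: L', hm, rfl⟩

theorem chain_card {μ ν : YoungDiagram} {L : List YoungDiagram} (h : L ∈ chainSet μ ν) :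
    μ.card + L.length = ν.card + 1 := by
  induction L generalizing μ with
  | nil => simp [chainSet] at h
  | cons a L ih =>
    obtain ⟨h1, h2, h3⟩ := h
    simp only [List.head?_cons, Option.some.injEq] at h2
    subst h2
    cases L with
    | nil =>
      simp only [List.getLast?_singleton, Option.some.injEq] at h3
      subst h3; simp
    | cons b L =>
      have h1' := List.isChain_cons_cons.1 h1
      have := ih (μ := b) ⟨h1'.2, rfl, by rw [List.getLast?_cons_cons] at h3; exact h3⟩
      have := h1'.1.2
      simp only [List.length_cons] at *
      omega

theorem chainSet_eq {d : ℕ} {μ ν : YoungDiagram} (h : ν.card = μ.card + d) :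
    chainSet μ ν = ↑(chF d μ ν) := by
  ext L
  rw [Finset.mem_coe, mem_chF]
  constructor
  · intro hL; exact ⟨hL, by have := chain_card hL; omega⟩
  · exact fun h => h.1

theorem chainSet_empty {μ ν : YoungDiagram} (h : ν.card < μ.card) : chainSet μ ν = ∅ := by
  ext L
  simp only [Set.mem_empty_iff_false, iff_false]
  intro hL
  have := chain_card hL
  have : L ≠ [] := by rintro rfl; simp [chainSet] at hL
  have := List.length_pos_of_ne_nil this
  omega

end chains

section conv
variable {n : ℕ}

theorem Ew_small (w : List (Fin n × ℤ)) {μ ν : YoungDiagram} (h : ν.card < μ.card) :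
    Ew w (dl ν) μ = 0 := by
  induction w generalizing μ with
  | nil => simp only [Ew, dl]; rw [if_neg]; rintro rfl; omega
  | cons tb w ih =>
    simp only [Ew]
    rw [ih h]
    split_ifs with ha
    · rw [ih (by rw [card_addRow ha]; omega)]; simp
    · simp

def gL (L : List YoungDiagram) : ℕ → YoungDiagram := fun i => L.getD i ⊥

theorem Ew_Nb (τ : ℕ × ℕ → Fin n) (l : List (ℕ × ℕ)) (hl : l.Pairwise ColLT) (ν : YoungDiagram)
    (d : ℕ) (μ : YoungDiagram) (hd : ν.card = μ.card + d) :
    Ew (l.map (ent τ)) (dl ν) μ = ∑ L ∈ chF d μ ν, Nb τ l.toFinset (gL L) d := by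
  classical
  induction l generalizing μ d with
  | nil =>
    simp only [List.map_nil, Ew, List.toFinset_nil, dl]
    cases d with
    | zero =>
      simp only [Nb_empty_zero, chF]
      split_ifs <;> simp
    | succ d =>
      simp only [Nb_empty_succ, Finset.sum_const_zero]
      rw [if_neg]; rintro rfl; omega
  | cons c0 l ih =>
    rw [List.pairwise_cons] at hl
    have h0 : ∀ c ∈ l.toFinset, ColLT c0 c := fun c hc => hl.1 c (List.mem_toFinset.1 hc)
    simp only [List.map_cons, Ew, List.toFinset_cons]
    rw [ih hl.2 d μ hd, ← wt_eq]
    cases d with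
    | zero =>
      simp only [Nb_zero τ h0]
      rw [Finset.mul_sum]
      have : (if Addable μ (ent τ c0).1 then Ew (l.map (ent τ)) (dl ν) (addRow μ (ent τ c0).1)
          else 0) = 0 := by
        split_ifs with ha
        · apply Ew_small; rw [card_addRow ha]; omega
        · rfl
      rw [this, add_zero]
      apply Finset.sum_congr rfl
      intro L hL
      obtain ⟨L', rfl⟩ := chF_head hL
      rfl
    | succ d =>
      simp only [Nb_succ τ h0, Finset.sum_add_distrib]
      congr 1
      · rw [Finset.mul_sum]
        apply Finset.sum_congr rfl
        intro L hL
        obtain ⟨L', rfl⟩ := chF_head hL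
        rfl
      · rw [chF_sum]
        have e : ∀ κ, ∀ L ∈ chF d κ ν, (if (τ c0 : ℕ) = stepRow (gL (μ :: L) 0) (gL (μ :: L) 1) then
            Nb τ l.toFinset (fun i => gL (μ :: L) (i + 1)) d else 0) =
            if (τ c0 : ℕ) = stepRow μ κ then Nb τ l.toFinset (gL L) d else 0 := by
          intro κ L hL
          obtain ⟨L', rfl⟩ := chF_head hL
          rfl
        rw [Finset.sum_congr rfl fun κ _ => Finset.sum_congr rfl (e κ)]
        split_ifs with ha
        · have ih' := ih hl.2 d (addRow μ (ent τ c0).1) (by rw [card_addRow ha]; omega)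
          rw [ih']
          have hst : (τ c0 : ℕ) = stepRow μ (addRow μ (τ c0)) := (stepRow_addRow ha).symm
          by_cases hle : addRow μ (τ c0) ≤ ν
          · rw [Finset.sum_eq_single (addRow μ (τ c0))]
            · exact Finset.sum_congr rfl fun L _ => (if_pos hst).symm
            · intro κ hκ hne
              rw [Finset.mem_filter] at hκ
              apply Finset.sum_eq_zero; intro L _
              rw [if_neg]
              intro hs
              exact hne (covers_iff.1 ⟨hκ.2, hs.symm⟩).2
            · intro hn
              exact absurd (Finset.mem_filter.2 ⟨mem_below.2 hle, covers_addRow ha⟩) hn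
          · rw [Finset.sum_eq_zero, Finset.sum_eq_zero]
            · intro κ hκ
              rw [Finset.mem_filter] at hκ
              apply Finset.sum_eq_zero; intro L hL
              rw [if_neg]
              intro hs
              have := (covers_iff.1 ⟨hκ.2, hs.symm⟩).2
              exact hle (this ▸ chF_le hL)
            · intro L hL
              exact absurd (chF_le hL) hle
        · symm
          apply Finset.sum_eq_zero
          intro κ hκ
          rw [Finset.mem_filter] at hκ
          apply Finset.sum_eq_zero; intro L _
          rw [if_neg]
          intro hs
          exact ha (covers_iff.1 ⟨hκ.2, hs.symm⟩).1

theorem sum_TSet [NeZero n] (lam : YoungDiagram) (L : List YoungDiagram) :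
    (∑ᶠ p ∈ TSet (n := n) lam.cells L, open Classical in
      ∏ c : lam.cells,
        if ∃ i, p.2 i = c then (1 : ℤ)
        else ((rhoOf L p.2 c).rowLen (p.1 c) : ℤ) + (n : ℤ) - 2 * ((p.1 c : ℤ) + 1)
              - (((c : ℕ × ℕ).2 : ℤ) - ((c : ℕ × ℕ).1 : ℤ)) + 1) =
    ∑ T ∈ SS n lam, Nb (tot T) lam.cells (gL L) (L.length - 1) := by
  classical
  rw [finsum_mem_eq_sum_of_inter_support_eq (s := TSet (n := n) lam.cells L)
    (t := Finset.univ.filter fun p => p ∈ TSet (n := n) lam.cells L) _ (by congr 1; ext p; simp)]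
  rw [Finset.sum_filter, Fintype.sum_prod_type, SS, Finset.sum_filter]
  apply Finset.sum_congr rfl
  intro T _
  by_cases hT : IsSsyt lam.cells T
  swap
  · rw [if_neg hT]
    apply Finset.sum_eq_zero
    intro β _
    rw [if_neg]
    exact fun h => hT h.1
  rw [if_pos hT, ← Finset.sum_filter]
  unfold Nb
  refine Finset.sum_bij' (fun β _ => fun i => (β i : ℕ × ℕ))
    (fun γ hγ => fun i => ⟨γ i, Fintype.mem_piFinset.1 (Finset.mem_filter.1 hγ).1 i⟩) ?_ ?_ ?_ ?_ ?_
  · intro β hβ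
    rw [Finset.mem_filter] at hβ
    rw [Finset.mem_filter, Fintype.mem_piFinset]
    refine ⟨fun i => (β i).2, hβ.2.2.1, fun i => ?_⟩
    rw [tot_coe]
    exact hβ.2.2.2 i
  · intro γ hγ
    rw [Finset.mem_filter] at hγ
    rw [Finset.mem_filter]
    refine ⟨Finset.mem_univ _, hT, hγ.2.1, fun i => ?_⟩
    have := hγ.2.2 i
    rw [tot_mem T (Fintype.mem_piFinset.1 hγ.1 i)] at this
    exact this
  · intro β _; rfl
  · intro γ _; rfl
  · intro β _
    rw [← Finset.prod_coe_sort lam.cells]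
    apply Finset.prod_congr rfl
    intro c _
    unfold tm
    have e1 : (∃ i, β i = c) ↔ ∃ i, (β i : ℕ × ℕ) = c := by
      simp only [Subtype.ext_iff]
    by_cases h : ∃ i, β i = c
    · rw [if_pos h, if_pos (e1.1 h)]
    · rw [if_neg h, if_neg (fun h' => h (e1.2 h'))]
      unfold wt
      rw [tot_coe]
      unfold rhoOf gL
      congr!

theorem fcoef_eq [NeZero n] (lam μ ν : YoungDiagram) :
    fcoef n lam μ ν = ∑ T ∈ SS n lam, Ew ((cl lam).map (ent (tot T))) (dl ν) μ := by
  unfold fcoef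
  have h1 : (∑ᶠ L ∈ chainSet μ ν, ∑ T ∈ SS n lam, Nb (tot T) lam.cells (gL L) (L.length - 1)) =
    ∑ T ∈ SS n lam, Ew ((cl lam).map (ent (tot T))) (dl ν) μ := by
    by_cases hc : ν.card < μ.card
    · rw [chainSet_empty hc]
      simp only [Ew_small _ hc]
      simp
    · obtain ⟨d, hd⟩ := Nat.exists_eq_add_of_le (not_lt.1 hc)
      rw [chainSet_eq hd, finsum_mem_coe_finset, Finset.sum_comm]
      apply Finset.sum_congr rfl
      intro T _
      rw [Ew_Nb _ _ (cl_pairwise lam) ν d μ hd, cl_toFinset]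
      apply Finset.sum_congr rfl
      intro L hL
      rw [chF_length hL]; rfl
  rw [← h1]
  simp only [← sum_TSet]

end conv
end FactorialLR

namespace FactorialLR

section hooks
variable {n : ℕ}

theorem strict_gap {f : ℕ → ℕ} {m : ℕ} (hf : ∀ i, i + 1 < m → f i < f (i + 1)) {i i' : ℕ}
    (h : i ≤ i') (h' : i' < m) : f i + (i' - i) ≤ f i' := by
  induction i', h using Nat.le_induction with
  | base => simp
  | succ k hk ih =>
    have := ih (by omega)
    have := hf k h'
    omega

theorem sL_pt [NeZero n] (lam ρ : YoungDiagram) :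
    sL n lam (pt n ρ) = ∑ T ∈ SS n lam, ∏ c ∈ lam.cells,
      ((ρ.rowLen (n - 1 - (tot T c : ℕ)) : ℤ) + c.1 - c.2) := by
  rw [← sL_symm lam Fin.revPerm, sL_fill]
  apply Finset.sum_congr rfl
  intro T _
  rw [wprod_cl]
  apply Finset.prod_congr rfl
  intro c _
  have h := (tot T c).2
  have e1 : ((Fin.revPerm (tot T c) : Fin n) : ℕ) = n - 1 - (tot T c : ℕ) := by
    simp [Fin.val_rev]; omega
  simp only [Function.comp, pt, kx]
  rw [e1]
  have e2 : n - 1 - (n - 1 - (tot T c : ℕ)) = (tot T c : ℕ) := by omega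
  rw [e2]; push_cast; ring

theorem rowLen_anti' (ρ : YoungDiagram) {a b : ℕ} (h : a ≤ b) : ρ.rowLen b ≤ ρ.rowLen a :=
  ρ.rowLen_anti _ _ h

theorem ssyt_row [NeZero n] {lam : YoungDiagram} {T : lam.cells → Fin n} (hT : IsSsyt lam.cells T)
    {i j j' : ℕ} (h : j ≤ j') (hm : (i, j') ∈ lam) : tot T (i, j) ≤ tot T (i, j') := by
  have hm' : (i, j) ∈ lam.cells := lam.up_left_mem le_rfl h hm
  rw [tot_mem T hm', tot_mem T hm]
  exact hT.1 _ _ rfl h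

theorem ssyt_col [NeZero n] {lam : YoungDiagram} {T : lam.cells → Fin n} (hT : IsSsyt lam.cells T)
    {i i' j : ℕ} (h : i ≤ i') (hm : (i', j) ∈ lam) :
    (tot T (i, j) : ℕ) + (i' - i) ≤ (tot T (i', j) : ℕ) := by
  refine strict_gap (f := fun i => (tot T (i, j) : ℕ)) (m := lam.colLen j) ?_ h
    (YoungDiagram.mem_iff_lt_colLen.1 hm)
  intro k hk
  have h1 : (k, j) ∈ lam.cells := YoungDiagram.mem_iff_lt_colLen.2 (by omega)
  have h2 : (k + 1, j) ∈ lam.cells := YoungDiagram.mem_iff_lt_colLen.2 hk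
  rw [tot_mem T h1, tot_mem T h2]
  exact hT.2 _ _ (Nat.lt_succ_self k) rfl

theorem term_ne [NeZero n] {lam ρ : YoungDiagram} {T : lam.cells → Fin n}
    (hT : IsSsyt lam.cells T)
    (h : ∏ c ∈ lam.cells, ((ρ.rowLen (n - 1 - (tot T c : ℕ)) : ℤ) + c.1 - c.2) ≠ 0)
    {i j : ℕ} (hc : (i, j) ∈ lam) : j + 1 ≤ ρ.rowLen (n - 1 - (tot T (i, j) : ℕ)) := by
  rw [Finset.prod_ne_zero_iff] at h
  have h0 : (0, j) ∈ lam := lam.up_left_mem (Nat.zero_le i) le_rfl hc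
  have key : ∀ k, (0, k) ∈ lam → k + 1 ≤ ρ.rowLen (n - 1 - (tot T (0, k) : ℕ)) := by
    intro k
    induction k with
    | zero =>
      intro hk
      have := h _ hk
      simp at this
      omega
    | succ k ih =>
      intro hk
      have h1 := h _ hk
      have h2 := ih (lam.up_left_mem le_rfl (Nat.le_succ k) hk)
      have h3 : (tot T (0, k) : ℕ) ≤ tot T (0, k + 1) := ssyt_row hT (Nat.le_succ k) hk
      have h4 := rowLen_anti' ρ (show n - 1 - (tot T (0, k + 1) : ℕ) ≤ n - 1 - (tot T (0, k) : ℕ) by omega)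
      simp only at h1
      push_cast at h1
      omega
  refine (key j h0).trans (rowLen_anti' ρ ?_)
  have := ssyt_col hT (Nat.zero_le i) hc
  omega

theorem sL_zero [NeZero n] {lam ρ : YoungDiagram} (h : ¬ lam ≤ ρ) : sL n lam (pt n ρ) = 0 := by
  rw [sL_pt]
  apply Finset.sum_eq_zero
  intro T hT
  by_contra hne
  have hT' : IsSsyt lam.cells T := by simpa [SS] using hT
  apply h
  rintro ⟨i, j⟩ hc
  change (i, j) ∈ ρ
  have hc' : i < lam.colLen j := YoungDiagram.mem_iff_lt_colLen.1 hc
  have h1 : (lam.colLen j - 1, j) ∈ lam := YoungDiagram.mem_iff_lt_colLen.2 (by omega)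
  have h2 : (lam.colLen j - 1 - i, j) ∈ lam := YoungDiagram.mem_iff_lt_colLen.2 (by omega)
  have h3 := term_ne hT' hne h2
  have h4 := ssyt_col hT' (show lam.colLen j - 1 - i ≤ lam.colLen j - 1 by omega) h1
  have h5 := (tot T (lam.colLen j - 1, j)).2
  have h6 := rowLen_anti' ρ (show i ≤ n - 1 - (tot T (lam.colLen j - 1 - i, j) : ℕ) by omega)
  exact YoungDiagram.mem_iff_lt_rowLen.2 (by omega)

/-- product of hook lengths -/
def hookP (lam : YoungDiagram) : ℤ :=
  ∏ c ∈ lam.cells, ((lam.rowLen c.1 : ℤ) + lam.colLen c.2 - 1 - c.1 - c.2)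

theorem hookP_transpose (lam : YoungDiagram) : hookP lam.transpose = hookP lam := by
  unfold hookP
  refine Finset.prod_nbij' Prod.swap Prod.swap ?_ ?_ ?_ ?_ ?_
  · intro c hc; simpa using hc
  · intro c hc
    rw [YoungDiagram.mem_cells, YoungDiagram.mem_transpose]; simpa using hc
  · intro c _; simp
  · intro c _; simp
  · intro c _; simp only [YoungDiagram.rowLen_transpose, YoungDiagram.colLen_transpose, Prod.fst_swap, Prod.snd_swap]; ring

theorem sL_self [NeZero n] {lam : YoungDiagram} (hl : lam.colLen 0 ≤ n) :
    sL n lam (pt n lam) = hookP lam := by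
  classical
  have hcol : ∀ j, lam.colLen j ≤ n := fun j => (lam.colLen_anti _ _ (Nat.zero_le j)).trans hl
  rw [sL_pt]
  let T0 : lam.cells → Fin n := fun c => ⟨n - lam.colLen c.1.2 + c.1.1, by
    have : c.1.1 < lam.colLen c.1.2 := YoungDiagram.mem_iff_lt_colLen.1 c.2
    have := hcol c.1.2
    omega⟩
  have hT0 : T0 ∈ SS n lam := by
    simp only [SS, Finset.mem_filter, Finset.mem_univ, true_and]
    constructor
    · intro c c' h h'
      have := lam.colLen_anti _ _ h'
      simp only [T0, Fin.mk_le_mk]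
      omega
    · intro c c' h h'
      simp only [T0, Fin.mk_lt_mk]
      rw [h']; omega
  rw [Finset.sum_eq_single_of_mem T0 hT0]
  · unfold hookP
    refine Finset.prod_nbij' (fun c => (lam.colLen c.2 - 1 - c.1, c.2))
      (fun c => (lam.colLen c.2 - 1 - c.1, c.2)) ?_ ?_ ?_ ?_ ?_
    · rintro ⟨i, j⟩ hc
      have : i < lam.colLen j := YoungDiagram.mem_iff_lt_colLen.1 hc
      exact YoungDiagram.mem_iff_lt_colLen.2 (by simp only; omega)
    · rintro ⟨i, j⟩ hc
      have : i < lam.colLen j := YoungDiagram.mem_iff_lt_colLen.1 hc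
      exact YoungDiagram.mem_iff_lt_colLen.2 (by simp only; omega)
    · rintro ⟨i, j⟩ hc
      have : i < lam.colLen j := YoungDiagram.mem_iff_lt_colLen.1 hc
      simp only [Prod.mk.injEq, and_true]; omega
    · rintro ⟨i, j⟩ hc
      have : i < lam.colLen j := YoungDiagram.mem_iff_lt_colLen.1 hc
      simp only [Prod.mk.injEq, and_true]; omega
    · rintro ⟨i, j⟩ hc
      have h1 : i < lam.colLen j := YoungDiagram.mem_iff_lt_colLen.1 hc
      have h2 := hcol j
      rw [tot_mem T0 hc]
      simp only [T0]
      have e : n - 1 - (n - lam.colLen j + i) = lam.colLen j - 1 - i := by omega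
      rw [e]
      have e2 : ((lam.colLen j - 1 - i : ℕ) : ℤ) = lam.colLen j - 1 - i := by omega
      rw [e2]; ring
  · intro T hT hne
    by_contra hz
    have hT' : IsSsyt lam.cells T := by simpa [SS] using hT
    apply hne
    funext c
    obtain ⟨⟨i, j⟩, hc⟩ := c
    have hc' : i < lam.colLen j := YoungDiagram.mem_iff_lt_colLen.1 hc
    have h1 : (lam.colLen j - 1, j) ∈ lam := YoungDiagram.mem_iff_lt_colLen.2 (by omega)
    have h0 : (0, j) ∈ lam := YoungDiagram.mem_iff_lt_colLen.2 (by omega)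
    have h3 := term_ne hT' hz h0
    have h3' : (n - 1 - (tot T (0, j) : ℕ), j) ∈ lam := YoungDiagram.mem_iff_lt_rowLen.2 (by omega)
    have h3'' := YoungDiagram.mem_iff_lt_colLen.1 h3'
    have h4 := ssyt_col hT' (show i ≤ lam.colLen j - 1 by omega) h1
    have h5 := ssyt_col hT' (Nat.zero_le i) hc
    have h6 := (tot T (lam.colLen j - 1, j)).2
    have h7 := hcol j
    ext
    simp only [T0]
    rw [← tot_mem T hc]
    omega

end hooks

section final
variable {n : ℕ} [NeZero n]

theorem main_id (lam : YoungDiagram) {μ : YoungDiagram} (hμ : μ.colLen 0 ≤ n) (ρ : YoungDiagram) :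
    (sL n lam (pt n ρ) : ℚ) * gq n μ ρ = ∑ ν ∈ below ρ, (fcoef n lam μ ν : ℚ) * gq n ν ρ := by
  have h := Mmain lam μ (pt n ρ)
  rw [YfE_fill] at h
  have h2 : ∀ T ∈ SS n lam, Ew ((cl lam).map (ent (tot T))) (fun ν => Af n ν (pt n ρ)) μ =
      ∑ ν ∈ below ρ, Af n ν (pt n ρ) * Ew ((cl lam).map (ent (tot T))) (dl ν) μ := by
    intro T _
    apply Ew_expand _ hμ
    intro ν hν hn
    rw [mem_below] at hn
    exact Af_pt_zero hν hn
  rw [Finset.sum_congr rfl h2, Finset.sum_comm] at h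
  simp only [← Finset.mul_sum, ← fcoef_eq] at h
  have h' : (sL n lam (pt n ρ) : ℚ) * (Af n μ (pt n ρ) : ℚ) =
      ∑ ν ∈ below ρ, (Af n ν (pt n ρ) : ℚ) * (fcoef n lam μ ν : ℚ) := by exact_mod_cast h.symm
  unfold gq
  rw [← mul_div_assoc, h', Finset.sum_div]
  apply Finset.sum_congr rfl
  intro ν _; ring

theorem bot_rows : (⊥ : YoungDiagram).colLen 0 ≤ n := by
  rw [colLen_le_iff]; intro s _
  by_contra h
  have : ((s, 0) : ℕ × ℕ) ∈ (⊥ : YoungDiagram) := YoungDiagram.mem_iff_lt_rowLen.2 (by omega)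
  simp at this

theorem fcoef_bot_zero {lam : YoungDiagram} (k : ℕ) : ∀ ν : YoungDiagram, ν.card = k →
    ν.colLen 0 ≤ n → ν ≠ lam → fcoef n lam ⊥ ν = 0 := by
  induction k using Nat.strong_induction_on with
  | _ k ih =>
  intro ν hk hν hne
  by_cases hc : lam.card < ν.card
  · rw [fcoef_eq]
    apply Finset.sum_eq_zero
    intro T _
    apply Ew_card
    rw [List.length_map, cl_length]
    have hb : (⊥ : YoungDiagram).card = 0 := rfl
    omega
  · have h := main_id (n := n) lam bot_rows ν
    rw [sL_zero, Finset.sum_eq_single_of_mem ν (mem_below.2 le_rfl), gq_self] at h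
    · simpa using h.symm
    · intro ν' hν' hne'
      rw [mem_below] at hν'
      have hlt : ν'.card < ν.card := by
        by_contra hh
        exact hne' (eq_of_card hν' (by omega))
      rw [ih ν'.card (hk ▸ hlt) ν' rfl (le_rows hν' hν)]
      · simp
      · rintro rfl; omega
    · intro hle
      exact hne (eq_of_card hle (by omega)).symm

theorem sL_gq {lam ρ : YoungDiagram} (hl : lam.colLen 0 ≤ n) (hρ : ρ.colLen 0 ≤ n) :
    (sL n lam (pt n ρ) : ℚ) * gq n ⊥ ρ = (fcoef n lam ⊥ lam : ℚ) * gq n lam ρ := by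
  rw [main_id lam bot_rows ρ]
  by_cases h : lam ≤ ρ
  · apply Finset.sum_eq_single_of_mem lam (mem_below.2 h)
    intro ν hν hne
    rw [mem_below] at hν
    rw [fcoef_bot_zero ν.card ν rfl (le_rows hν hρ) hne]; simp
  · rw [gq_zero hl h, mul_zero]
    apply Finset.sum_eq_zero
    intro ν hν
    rw [mem_below] at hν
    rw [fcoef_bot_zero ν.card ν rfl (le_rows hν hρ)]
    · simp
    · rintro rfl; exact h hν

theorem gq_tr {μ ρ : YoungDiagram} (hμ : μ.colLen 0 ≤ n) (hμ' : μ.transpose.colLen 0 ≤ n)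
    (hρ : ρ.colLen 0 ≤ n) (hρ' : ρ.transpose.colLen 0 ≤ n) :
    gq n μ.transpose ρ.transpose = gq n μ ρ := by
  by_cases h : μ ≤ ρ
  · obtain ⟨d, hd⟩ := Nat.exists_eq_add_of_le (card_mono h)
    exact gq_transpose hρ hρ' d μ h hd
  · rw [gq_zero hμ h, gq_zero hμ' (fun h' => h (transpose_le.1 h'))]

theorem bot_transpose : (⊥ : YoungDiagram).transpose = ⊥ := by
  ext c; simp [YoungDiagram.mem_transpose]

theorem gq_bot_pos {ρ : YoungDiagram} (hρ : ρ.colLen 0 ≤ n) : 0 < gq n ⊥ ρ :=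
  gq_pos hρ ρ.card ⊥ bot_le (by simp)

theorem gq_bot_tr {ρ : YoungDiagram} (hρ : ρ.colLen 0 ≤ n) (hρ' : ρ.transpose.colLen 0 ≤ n) :
    gq n ⊥ ρ.transpose = gq n ⊥ ρ := by
  have := gq_tr (n := n) (μ := ⊥) bot_rows (by rw [bot_transpose]; exact bot_rows) hρ hρ'
  rwa [bot_transpose] at this

theorem kappa_tr {lam : YoungDiagram} (hl : lam.colLen 0 ≤ n) (hl' : lam.transpose.colLen 0 ≤ n) :
    (fcoef n lam.transpose ⊥ lam.transpose : ℚ) = fcoef n lam ⊥ lam := by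
  have h1 := sL_gq hl hl
  have h2 := sL_gq hl' hl'
  rw [sL_self hl, gq_self, mul_one] at h1
  rw [sL_self hl', gq_self, mul_one, hookP_transpose, gq_bot_tr hl hl'] at h2
  rw [← h1, ← h2]

theorem sL_tr {lam ρ : YoungDiagram} (hl : lam.colLen 0 ≤ n) (hl' : lam.transpose.colLen 0 ≤ n)
    (hρ : ρ.colLen 0 ≤ n) (hρ' : ρ.transpose.colLen 0 ≤ n) :
    (sL n lam.transpose (pt n ρ.transpose) : ℚ) = sL n lam (pt n ρ) := by
  have h1 := sL_gq hl hρ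
  have h2 := sL_gq hl' hρ'
  rw [gq_bot_tr hρ hρ', kappa_tr hl hl', gq_tr hl hl' hρ hρ', ← h1] at h2
  exact mul_right_cancel₀ (gq_bot_pos hρ).ne' h2

theorem fcoef_tr {lam μ : YoungDiagram} (hl : lam.colLen 0 ≤ n) (hl' : lam.transpose.colLen 0 ≤ n)
    (hμ : μ.colLen 0 ≤ n) (hμ' : μ.transpose.colLen 0 ≤ n) (k : ℕ) : ∀ ρ : YoungDiagram,
    ρ.card = k → ρ.colLen 0 ≤ n → ρ.transpose.colLen 0 ≤ n →
    (fcoef n lam.transpose μ.transpose ρ.transpose : ℚ) = fcoef n lam μ ρ := by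
  classical
  induction k using Nat.strong_induction_on with
  | _ k ih =>
  intro ρ hk hρ hρ'
  have h1 := main_id lam hμ ρ
  have h2 := main_id lam.transpose hμ' ρ.transpose
  rw [sL_tr hl hl' hρ hρ', gq_tr hμ hμ' hρ hρ', h1] at h2
  have e : ∑ ν ∈ below ρ.transpose, (fcoef n lam.transpose μ.transpose ν : ℚ) * gq n ν ρ.transpose =
      ∑ ν ∈ below ρ, (fcoef n lam.transpose μ.transpose ν.transpose : ℚ) * gq n ν ρ := by
    symm
    refine Finset.sum_nbij' YoungDiagram.transpose YoungDiagram.transpose ?_ ?_ ?_ ?_ ?_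
    · intro ν hν
      rw [mem_below] at hν ⊢; exact transpose_le.2 hν
    · intro ν hν
      rw [mem_below] at hν ⊢; rw [← transpose_le]; simpa using hν
    · intro ν _; simp
    · intro ν _; simp
    · intro ν hν
      rw [mem_below] at hν
      rw [gq_tr (le_rows hν hρ) (le_rows (transpose_le.2 hν) hρ') hρ hρ']
  rw [e, ← Finset.sum_erase_add _ _ (mem_below.2 (le_refl ρ)),
    ← Finset.sum_erase_add _ _ (mem_below.2 (le_refl ρ)), gq_self, mul_one, mul_one] at h2
  have e2 : ∑ ν ∈ (below ρ).erase ρ, (fcoef n lam.transpose μ.transpose ν.transpose : ℚ) * gq n ν ρ =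
      ∑ ν ∈ (below ρ).erase ρ, (fcoef n lam μ ν : ℚ) * gq n ν ρ := by
    apply Finset.sum_congr rfl
    intro ν hν
    rw [Finset.mem_erase, mem_below] at hν
    have hlt : ν.card < ρ.card := by
      by_contra hh
      exact hν.1 (eq_of_card hν.2 (by omega))
    rw [ih ν.card (hk ▸ hlt) ν rfl (le_rows hν.2 hρ) (le_rows (transpose_le.2 hν.2) hρ')]
  rw [e2] at h2
  exact (add_left_cancel h2).symm

end final
end FactorialLR

namespace FactorialLR

/-- **Symmetry under conjugation:** `f^{ν^t}_{λ^t μ^t} = f^ν_{λμ}`. -/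
theorem fcoef_transpose (n : ℕ) (hn : 1 ≤ n) (lam mu nu : YoungDiagram)
    (hlam : lam.colLen 0 ≤ n) (hmu : mu.colLen 0 ≤ n) (hnu : nu.colLen 0 ≤ n)
    (hlam' : lam.transpose.colLen 0 ≤ n) (hmu' : mu.transpose.colLen 0 ≤ n)
    (hnu' : nu.transpose.colLen 0 ≤ n) :
    fcoef n lam.transpose mu.transpose nu.transpose = fcoef n lam mu nu := by
  haveI : NeZero n := ⟨by omega⟩
  exact_mod_cast fcoef_tr hlam hlam' hmu hmu' nu.card nu rfl hnu hnu'

end FactorialLR
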